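/- arXiv:1604.08166 — 3 statements merged into one kernel-verified Lean document; each statement's English description precedes it below -/
import Mathlib

section
/- (Barański's theorem, reproved.) Let Λ_Φ be a Barański carpet, i.e. a two-dimensional Barański sponge. Then HD(Λ_Φ) = sup_{p∈P} HD(ν_p), the supremum of the Hausdorff dimensions of its Bernoulli measures. -/
open MeasureTheory Filter Set Metric
open scoped Classical Topology ENNReal NNReal

namespace SelfAffineSponge

/-- A diagonal IFS on `[0,1]^d`: for each coordinate `i ∈ D = Fin d` a finite alphabet
`A i` indexing affine maps `x ↦ slope i a * x + off i a` of `[0,1]`, together with a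
set `E ⊆ ∏ i, A i` of allowed tuples of symbols. -/
structure DiagIFS (d : ℕ) (A : Fin d → Type) [∀ i, Fintype (A i)] where
  slope : ∀ i : Fin d, A i → ℝ
  off : ∀ i : Fin d, A i → ℝ
  E : Finset (∀ i, A i)

variable {d : ℕ} {A : Fin d → Type} [∀ i, Fintype (A i)]

namespace DiagIFS

/-- the base similarity `φ_{i,a}` in coordinate `i` -/
def base (Φ : DiagIFS d A) (i : Fin d) (a : A i) (x : ℝ) : ℝ :=
  Φ.slope i a * x + Φ.off i a

/-- the data defines an honest diagonal IFS: `E` is nonempty and each base map is a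
contracting similarity of `[0,1]` -/
def Valid (Φ : DiagIFS d A) : Prop :=
  Φ.E.Nonempty ∧ (∀ i a, Φ.slope i a ≠ 0) ∧ (∀ i a, |Φ.slope i a| < 1) ∧
    ∀ i a, ∀ x ∈ Set.Icc (0:ℝ) 1, Φ.base i a x ∈ Set.Icc (0:ℝ) 1

/-- the alphabet `E` of the IFS, as a type -/
abbrev Symb (Φ : DiagIFS d A) : Type _ := {a : ∀ i, A i // a ∈ Φ.E}

instance (Φ : DiagIFS d A) : MeasurableSpace Φ.Symb := ⊤
instance (Φ : DiagIFS d A) : TopologicalSpace Φ.Symb := ⊥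

/-- the affine contraction `φ_a` of `[0,1]^d` associated to a tuple of symbols -/
def affMap (Φ : DiagIFS d A) (a : ∀ i, A i) (x : Fin d → ℝ) : Fin d → ℝ :=
  fun i => Φ.base i (a i) (x i)

/-- the coding map `π(ω) = lim_n φ_{ω_0}∘⋯∘φ_{ω_{n-1}}(0)`, written in closed form -/
noncomputable def coding (Φ : DiagIFS d A) (ω : ℕ → Φ.Symb) : Fin d → ℝ :=
  fun i => ∑' n : ℕ, (∏ k ∈ Finset.range n, Φ.slope i ((ω k).1 i)) * Φ.off i ((ω n).1 i)

/-- the limit set `Λ_Φ = π(E^ℕ)` (the self-affine sponge) -/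
def limitSet (Φ : DiagIFS d A) : Set (Fin d → ℝ) :=
  Set.range Φ.coding

theorem coding_mem (Φ : DiagIFS d A) (ω : ℕ → Φ.Symb) : Φ.coding ω ∈ Φ.limitSet :=
  ⟨ω, rfl⟩

/-- the `i`-th Lyapunov exponent `χ_i(p) = -∫ log|φ'_{a,i}| dp(a)` of a finite measure
`p` on `E` (given by its density) -/
noncomputable def chi (Φ : DiagIFS d A) (i : Fin d) (p : Φ.Symb → ℝ) : ℝ :=
  -∑ a : Φ.Symb, p a * Real.log |Φ.slope i (a.1 i)|

/-- the mass `p([a]_I)` of the cylinder `[a]_I = {b ∈ E : b_i = a_i ∀ i ∈ I}` -/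
noncomputable def cylMass (Φ : DiagIFS d A) (I : Finset (Fin d)) (p : Φ.Symb → ℝ)
    (a : Φ.Symb) : ℝ :=
  ∑ b : Φ.Symb, if ∀ i ∈ I, b.1 i = a.1 i then p b else 0

/-- the entropy `h(I; p) = -∫ log p([a]_I) dp(a)` -/
noncomputable def entropy (Φ : DiagIFS d A) (I : Finset (Fin d)) (p : Φ.Symb → ℝ) : ℝ :=
  -∑ a : Φ.Symb, p a * Real.log (Φ.cylMass I p a)

/-- the conditional entropy `h(I' | I; p) = h(I';p) - h(I;p)` -/
noncomputable def condEntropy (Φ : DiagIFS d A) (I I' : Finset (Fin d))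
    (p : Φ.Symb → ℝ) : ℝ :=
  Φ.entropy I' p - Φ.entropy I p

/-- a coordinate set `I ⊆ D` is good if the projected IFS `Φ_I` satisfies the open set
condition: the boxes `φ_{I,a}((0,1)^I)`, indexed by distinct projections of elements of
`E`, are pairwise disjoint (equivalently, some coordinate has disjoint intervals). -/
def GoodIdx (Φ : DiagIFS d A) (I : Finset (Fin d)) : Prop :=
  ∀ a ∈ Φ.E, ∀ b ∈ Φ.E, (∃ i ∈ I, a i ≠ b i) →
    ∃ i ∈ I, Disjoint (Φ.base i (a i) '' Set.Ioo (0:ℝ) 1)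
      (Φ.base i (b i) '' Set.Ioo (0:ℝ) 1)

/-- Barański condition: each base IFS satisfies the open set condition w.r.t. `(0,1)` -/
def Baranski (Φ : DiagIFS d A) : Prop :=
  ∀ i : Fin d, ∀ a b : A i, a ≠ b →
    Disjoint (Φ.base i a '' Set.Ioo (0:ℝ) 1) (Φ.base i b '' Set.Ioo (0:ℝ) 1)

/-- strong Barański condition: each base IFS satisfies the strong separation condition
w.r.t. `[0,1]` -/
def StronglyBaranski (Φ : DiagIFS d A) : Prop :=
  ∀ i : Fin d, ∀ a b : A i, a ≠ b →
    Disjoint (Φ.base i a '' Set.Icc (0:ℝ) 1) (Φ.base i b '' Set.Icc (0:ℝ) 1)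

/-- coordinate ordering condition: some permutation `σ` of the coordinates has
`|φ'_{a,σ(1)}| > ⋯ > |φ'_{a,σ(d)}|` for all `a ∈ E` -/
def CoordOrdering (Φ : DiagIFS d A) : Prop :=
  ∃ σ : Equiv.Perm (Fin d), ∀ a ∈ Φ.E, ∀ i j : Fin d, i < j →
    |Φ.slope (σ j) (a (σ j))| < |Φ.slope (σ i) (a (σ i))|

end DiagIFS

/-- a probability vector (probability measure on a finite set, via its density) -/
def IsProbVec {α : Type*} [Fintype α] (p : α → ℝ) : Prop :=
  (∀ a, 0 ≤ p a) ∧ ∑ a, p a = 1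

/-- a measure `p` on `E` is good if `I(p,x) = {i : χ_i(p) ≤ x}` is good for all `x > 0` -/
def DiagIFS.GoodVec (Φ : DiagIFS d A) (p : Φ.Symb → ℝ) : Prop :=
  ∀ x > 0, Φ.GoodIdx (Finset.univ.filter fun i => Φ.chi i p ≤ x)

/-- a cycle on `E`: a continuous exponentially `λ`-periodic map `(0,∞) → P`,
where `λ = 1` means constant -/
structure Cycle (Φ : DiagIFS d A) where
  lam : ℝ
  one_le_lam : 1 ≤ lam
  r : ℝ → Φ.Symb → ℝ
  prob : ∀ b > 0, IsProbVec (r b)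
  cont : ContinuousOn r (Set.Ioi 0)
  periodic : ∀ b > 0, r (lam * b) = r b
  const_of_lam_eq_one : lam = 1 → ∀ b > 0, ∀ b' > 0, r b = r b'

/-- the number `B_i`, determined by `B = ∫_0^{B_i} χ_i(r_b) db` (written via `sInf`;
for a cycle the function `x ↦ ∫_0^x χ_i(r_b) db` is continuous and strictly
increasing, so the infimum is the unique solution) -/
noncomputable def Bcoord (Φ : DiagIFS d A) (r : ℝ → Φ.Symb → ℝ) (B : ℝ) (i : Fin d) : ℝ :=
  sInf {x : ℝ | 0 ≤ x ∧ B ≤ ∫ b in Set.Ioc (0:ℝ) x, Φ.chi i (r b)}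

/-- `δ(r, B) = B⁻¹ ∫_0^∞ h({i : b ≤ B_i}; r_b) db` -/
noncomputable def deltaRB (Φ : DiagIFS d A) (r : ℝ → Φ.Symb → ℝ) (B : ℝ) : ℝ :=
  B⁻¹ * ∫ b in Set.Ioi (0:ℝ),
    Φ.entropy (Finset.univ.filter fun i => b ≤ Bcoord Φ r B i) (r b)

/-- `δ(r) = inf_{B ∈ [1,λ]} δ(r,B)` -/
noncomputable def Cycle.delta {Φ : DiagIFS d A} (c : Cycle Φ) : ℝ :=
  sInf (deltaRB Φ c.r '' Set.Icc 1 c.lam)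

/-- `δ(p) = ∫_0^∞ h({i : b ≤ 1/χ_i(p)}; p) db` -/
noncomputable def deltaP (Φ : DiagIFS d A) (p : Φ.Symb → ℝ) : ℝ :=
  ∫ b in Set.Ioi (0:ℝ),
    Φ.entropy (Finset.univ.filter fun i => b ≤ (Φ.chi i p)⁻¹) p

/-- the normalized average `R̂_B = B⁻¹ ∫_0^B r_b db` of a cycle -/
noncomputable def cycleAvg {Φ : DiagIFS d A} (c : Cycle Φ) (B : ℝ) : Φ.Symb → ℝ :=
  fun a => B⁻¹ * ∫ b in Set.Ioc (0:ℝ) B, c.r b a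

/-- a cycle is good if all its normalized averages `R̂_B` are good -/
def Cycle.Good {Φ : DiagIFS d A} (c : Cycle Φ) : Prop :=
  ∀ B > 0, Φ.GoodVec (cycleAvg c B)

/-- a cycle is nondegenerate if `{b > 0 : r_b(a) > 0 ∀ a ∈ E_r}` is dense in `(0,∞)` -/
def Cycle.Nondeg {Φ : DiagIFS d A} (c : Cycle Φ) : Prop :=
  Set.Ioi (0:ℝ) ⊆
    closure {b : ℝ | 0 < b ∧ ∀ a : Φ.Symb, (∃ b' > 0, 0 < c.r b' a) → 0 < c.r b a}

/-- the lower pointwise dimension `d̲(x,μ) = liminf_{ρ→0} log μ(B(x,ρ))/log ρ` -/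
noncomputable def lowerPtDim {X : Type*} [PseudoMetricSpace X] [MeasurableSpace X]
    (μ : Measure X) (x : X) : ℝ≥0∞ :=
  Filter.liminf
    (fun ρ : ℝ => ENNReal.ofReal (Real.log (μ (Metric.ball x ρ)).toReal / Real.log ρ))
    (𝓝[>] (0:ℝ))

/-- the Hausdorff dimension of a measure: the essential supremum of its lower
pointwise dimension -/
noncomputable def measDim {X : Type*} [PseudoMetricSpace X] [MeasurableSpace X]
    (μ : Measure X) : ℝ≥0∞ :=
  essSup (lowerPtDim μ) μ

/-- the shift map on `E^ℕ` -/
def shift {α : Type*} (ω : ℕ → α) : ℕ → α := fun n => ω (n + 1)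

/-- the dynamical dimension: the supremum of `HD(π_*μ)` over shift-invariant
probability measures `μ` on `E^ℕ` -/
noncomputable def DiagIFS.dynDim (Φ : DiagIFS d A) : ℝ≥0∞ :=
  sSup {x : ℝ≥0∞ | ∃ μ : Measure (ℕ → Φ.Symb), IsProbabilityMeasure μ ∧
    Measure.map shift μ = μ ∧ x = measDim (Measure.map Φ.coding μ)}

/-- `μ` is the product measure on `E^ℕ` whose `k`-th factor has density `p k`
(this property characterizes `μ` uniquely) -/
def IsProductMeasure (Φ : DiagIFS d A) (p : ℕ → Φ.Symb → ℝ)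
    (μ : Measure (ℕ → Φ.Symb)) : Prop :=
  IsProbabilityMeasure μ ∧
    ∀ (n : ℕ) (w : ℕ → Φ.Symb),
      (μ {ω | ∀ k < n, ω k = w k}).toReal = ∏ k ∈ Finset.range n, p k (w k)

/-- the set of Hausdorff dimensions of Bernoulli measures `ν_p = π_*[p^ℕ]` -/
noncomputable def bernoulliDims (Φ : DiagIFS d A) : Set ℝ≥0∞ :=
  {x | ∃ p : Φ.Symb → ℝ, IsProbVec p ∧ ∃ μ : Measure (ℕ → Φ.Symb),
    IsProductMeasure Φ (fun _ => p) μ ∧ x = measDim (Measure.map Φ.coding μ)}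

/-- the set of Hausdorff dimensions of pseudo-Bernoulli measures
`ν_r = π_*[∏_n r_n]` -/
noncomputable def pseudoBernoulliDims (Φ : DiagIFS d A) : Set ℝ≥0∞ :=
  {x | ∃ c : Cycle Φ, ∃ μ : Measure (ℕ → Φ.Symb),
    IsProductMeasure Φ (fun n => c.r ((n : ℝ) + 1)) μ ∧
      x = measDim (Measure.map Φ.coding μ)}

section Coding

/-- The exponent `-log |φ_{i,a}'|` of a base map. -/
noncomputable def DiagIFS.lyap (Φ : DiagIFS d A) (i : Fin d) (a : A i) : ℝ :=
  -Real.log |Φ.slope i a|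

/-- The coding map in a single coordinate. -/
noncomputable def DiagIFS.code (Φ : DiagIFS d A) (i : Fin d) (w : ℕ → A i) : ℝ :=
  ∑' n : ℕ, (∏ k ∈ Finset.range n, Φ.slope i (w k)) * Φ.off i (w n)

variable {Φ : DiagIFS d A}

theorem DiagIFS.Valid.lyap_pos (hV : Φ.Valid) (i : Fin d) (a : A i) : 0 < Φ.lyap i a := by
  have h1 := hV.2.1 i a
  have h2 := hV.2.2.1 i a
  have := Real.log_neg (abs_pos.2 h1) h2
  unfold DiagIFS.lyap; linarith

theorem DiagIFS.Valid.exp_neg_lyap (hV : Φ.Valid) (i : Fin d) (a : A i) :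
    Real.exp (-Φ.lyap i a) = |Φ.slope i a| := by
  unfold DiagIFS.lyap
  rw [neg_neg, Real.exp_log (abs_pos.2 (hV.2.1 i a))]

theorem DiagIFS.Valid.exists_lyap_bounds (hV : Φ.Valid) :
    ∃ c C : ℝ, 0 < c ∧ 0 < C ∧ ∀ i a, c ≤ Φ.lyap i a ∧ Φ.lyap i a ≤ C := by
  have h1 : ∃ c : ℝ, 0 < c ∧ ∀ x : (i : Fin d) × A i, c ≤ Φ.lyap x.1 x.2 := by
    rcases isEmpty_or_nonempty ((i : Fin d) × A i) with h | h
    · exact ⟨1, one_pos, fun x => h.elim x⟩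
    · obtain ⟨x, hx⟩ := Finite.exists_min (fun x : (i : Fin d) × A i => Φ.lyap x.1 x.2)
      exact ⟨_, hV.lyap_pos x.1 x.2, hx⟩
  have h2 : ∃ C : ℝ, 0 < C ∧ ∀ x : (i : Fin d) × A i, Φ.lyap x.1 x.2 ≤ C := by
    rcases isEmpty_or_nonempty ((i : Fin d) × A i) with h | h
    · exact ⟨1, one_pos, fun x => h.elim x⟩
    · obtain ⟨x, hx⟩ := Finite.exists_max (fun x : (i : Fin d) × A i => Φ.lyap x.1 x.2)
      exact ⟨_, hV.lyap_pos x.1 x.2, hx⟩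
  obtain ⟨c, hc, h1⟩ := h1
  obtain ⟨C, hC, h2⟩ := h2
  exact ⟨c, C, hc, hC, fun i a => ⟨h1 ⟨i, a⟩, h2 ⟨i, a⟩⟩⟩

theorem DiagIFS.Valid.exists_rate (hV : Φ.Valid) :
    ∃ r : ℝ, 0 ≤ r ∧ r < 1 ∧ ∀ i a, |Φ.slope i a| ≤ r := by
  obtain ⟨c, C, hc, -, h⟩ := hV.exists_lyap_bounds
  refine ⟨Real.exp (-c), (Real.exp_pos _).le, by simpa using hc, fun i a => ?_⟩
  rw [← hV.exp_neg_lyap]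
  exact Real.exp_le_exp.2 (neg_le_neg (h i a).1)

theorem DiagIFS.Valid.off_mem (hV : Φ.Valid) (i : Fin d) (a : A i) :
    Φ.off i a ∈ Icc (0 : ℝ) 1 := by
  simpa [DiagIFS.base] using hV.2.2.2 i a 0 (by simp)

theorem DiagIFS.Valid.prod_eq (hV : Φ.Valid) (i : Fin d) (w : ℕ → A i) (n : ℕ) :
    |∏ k ∈ Finset.range n, Φ.slope i (w k)|
      = Real.exp (-∑ k ∈ Finset.range n, Φ.lyap i (w k)) := by
  rw [Finset.abs_prod, ← Finset.sum_neg_distrib, Real.exp_sum]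
  exact Finset.prod_congr rfl fun k _ => (hV.exp_neg_lyap i (w k)).symm

theorem DiagIFS.Valid.term_bound (hV : Φ.Valid) {r : ℝ}
    (hr : ∀ i a, |Φ.slope i a| ≤ r) (i : Fin d) (w : ℕ → A i) (n : ℕ) :
    ‖(∏ k ∈ Finset.range n, Φ.slope i (w k)) * Φ.off i (w n)‖ ≤ r ^ n := by
  rw [Real.norm_eq_abs, abs_mul, Finset.abs_prod]
  have h1 : ∏ k ∈ Finset.range n, |Φ.slope i (w k)| ≤ r ^ n := by
    calc _ ≤ ∏ k ∈ Finset.range n, r :=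
          Finset.prod_le_prod (fun _ _ => abs_nonneg _) fun k _ => hr _ _
      _ = r ^ n := by simp
  have h2 : |Φ.off i (w n)| ≤ 1 := by
    have := hV.off_mem i (w n)
    rw [abs_of_nonneg this.1]; exact this.2
  have h3 : 0 ≤ ∏ k ∈ Finset.range n, |Φ.slope i (w k)| :=
    Finset.prod_nonneg fun _ _ => abs_nonneg _
  nlinarith [abs_nonneg (Φ.off i (w n))]

theorem DiagIFS.Valid.summable_code (hV : Φ.Valid) (i : Fin d) (w : ℕ → A i) :
    Summable fun n : ℕ => (∏ k ∈ Finset.range n, Φ.slope i (w k)) * Φ.off i (w n) := by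
  obtain ⟨r, h0, h1, hr⟩ := hV.exists_rate
  exact Summable.of_norm_bounded (summable_geometric_of_lt_one h0 h1)
    (hV.term_bound hr i w)

theorem DiagIFS.Valid.code_eq_base (hV : Φ.Valid) (i : Fin d) (w : ℕ → A i) :
    Φ.code i w = Φ.base i (w 0) (Φ.code i fun k => w (k + 1)) := by
  unfold DiagIFS.code DiagIFS.base
  rw [(hV.summable_code i w).tsum_eq_zero_add, ← tsum_mul_left]
  simp only [Finset.prod_range_succ', Finset.range_zero, Finset.prod_empty, one_mul]
  rw [add_comm]
  congr 1
  exact tsum_congr fun n => by ring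

theorem DiagIFS.Valid.partial_mem (hV : Φ.Valid) (i : Fin d) (n : ℕ) (w : ℕ → A i) :
    ∑ m ∈ Finset.range n, (∏ k ∈ Finset.range m, Φ.slope i (w k)) * Φ.off i (w m)
      ∈ Icc (0 : ℝ) 1 := by
  induction n generalizing w with
  | zero => simp
  | succ n ih =>
    convert hV.2.2.2 i (w 0) _ (ih fun k => w (k + 1)) using 1
    rw [Finset.sum_range_succ', DiagIFS.base, Finset.mul_sum]
    simp only [Finset.prod_range_succ', Finset.range_zero, Finset.prod_empty, one_mul]
    congr 1
    exact Finset.sum_congr rfl fun n _ => by ring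

theorem DiagIFS.Valid.code_mem (hV : Φ.Valid) (i : Fin d) (w : ℕ → A i) :
    Φ.code i w ∈ Icc (0 : ℝ) 1 :=
  isClosed_Icc.mem_of_tendsto (hV.summable_code i w).hasSum.tendsto_sum_nat
    (Eventually.of_forall fun n => hV.partial_mem i n w)

theorem DiagIFS.Valid.code_sub (hV : Φ.Valid) (i : Fin d) (n : ℕ) (w w' : ℕ → A i)
    (h : ∀ k < n, w k = w' k) :
    Φ.code i w - Φ.code i w' = (∏ k ∈ Finset.range n, Φ.slope i (w k)) *
      (Φ.code i (fun k => w (k + n)) - Φ.code i fun k => w' (k + n)) := by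
  induction n generalizing w w' with
  | zero => simp
  | succ n ih =>
    rw [hV.code_eq_base i w, hV.code_eq_base i w', h 0 (by omega)]
    have := ih (fun k => w (k + 1)) (fun k => w' (k + 1)) fun k hk => h (k + 1) (by omega)
    simp only [add_assoc] at this
    rw [Finset.prod_range_succ', h 0 (by omega), mul_right_comm, ← this]
    unfold DiagIFS.base; ring

theorem DiagIFS.Valid.abs_code_sub_le (hV : Φ.Valid) (i : Fin d) (n : ℕ) (w w' : ℕ → A i)
    (h : ∀ k < n, w k = w' k) :
    |Φ.code i w - Φ.code i w'| ≤ Real.exp (-∑ k ∈ Finset.range n, Φ.lyap i (w k)) := by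
  rw [hV.code_sub i n w w' h, abs_mul, hV.prod_eq]
  have h1 := hV.code_mem i fun k => w (k + n)
  have h2 := hV.code_mem i fun k => w' (k + n)
  have : |(Φ.code i (fun k => w (k + n)) - Φ.code i fun k => w' (k + n))| ≤ 1 := by
    rw [abs_le]; constructor <;> linarith [h1.1, h1.2, h2.1, h2.2]
  exact mul_le_of_le_one_right (Real.exp_pos _).le this

theorem DiagIFS.Valid.continuous_coding (hV : Φ.Valid) : Continuous Φ.coding := by
  obtain ⟨r, h0, h1, hr⟩ := hV.exists_rate
  have : DiscreteTopology Φ.Symb := ⟨rfl⟩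
  refine continuous_pi fun i => ?_
  unfold DiagIFS.coding
  refine continuous_tsum (u := fun n => r ^ n) (fun n => ?_)
    (summable_geometric_of_lt_one h0 h1)
    fun n ω => hV.term_bound hr i (fun k => (ω k).1 i) n
  refine Continuous.mul (continuous_finsetProd _ fun k _ => ?_) ?_
  · exact (continuous_of_discreteTopology (f := fun a : Φ.Symb => Φ.slope i (a.1 i))).comp
      (continuous_apply k)
  · exact (continuous_of_discreteTopology (f := fun a : Φ.Symb => Φ.off i (a.1 i))).comp
      (continuous_apply n)

instance (Φ : DiagIFS d A) : DiscreteTopology Φ.Symb := ⟨rfl⟩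

instance (Φ : DiagIFS d A) : DiscreteMeasurableSpace Φ.Symb := ⟨fun _ => trivial⟩

theorem DiagIFS.Valid.measurable_coding (hV : Φ.Valid) : Measurable Φ.coding :=
  hV.continuous_coding.measurable

theorem DiagIFS.Valid.measurableSet_limitSet (hV : Φ.Valid) : MeasurableSet Φ.limitSet :=
  (isCompact_range hV.continuous_coding).measurableSet

end Coding

section Separation

variable {Φ : DiagIFS d A}

/-- The distance from a point of `[0,1]` to the endpoints. -/
noncomputable def endDist (y : ℝ) : ℝ := min y (1 - y)

theorem le_endDist_base (hV : Φ.Valid) (i : Fin d) (a : A i) {y : ℝ}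
    (hy : y ∈ Icc (0 : ℝ) 1) :
    |Φ.slope i a| * endDist y ≤ endDist (Φ.base i a y) := by
  have h0 := hV.2.2.2 i a 0 (by simp)
  have h1 := hV.2.2.2 i a 1 (by simp)
  unfold DiagIFS.base at *
  simp only [mul_zero, zero_add, mul_one, mem_Icc] at h0 h1
  obtain ⟨hy0, hy1⟩ := hy
  have m1 := min_le_left y (1 - y)
  have m2 := min_le_right y (1 - y)
  unfold endDist
  set m := min y (1 - y)
  rcases le_total 0 (Φ.slope i a) with h | h
  · rw [abs_of_nonneg h]
    refine le_min ?_ ?_ <;> nlinarith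
  · rw [abs_of_nonpos h]
    refine le_min ?_ ?_ <;> nlinarith

theorem endDist_le_abs_base_sub (hV : Φ.Valid) (hB : Φ.Baranski) (i : Fin d) {a b : A i}
    (hab : a ≠ b) {y y' : ℝ} (hy' : y' ∈ Icc (0 : ℝ) 1) :
    |Φ.slope i a| * endDist y ≤ |Φ.base i a y - Φ.base i b y'| := by
  by_contra! hlt
  have hs : Φ.slope i a ≠ 0 := hV.2.1 i a
  have hcont : Continuous fun t => (Φ.base i b t - Φ.off i a) / Φ.slope i a := by
    unfold DiagIFS.base; fun_prop
  have hmem : (Φ.base i b y' - Φ.off i a) / Φ.slope i a ∈ Ioo (0 : ℝ) 1 := by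
    have e : (Φ.base i b y' - Φ.off i a) / Φ.slope i a
        = y + (Φ.base i b y' - Φ.base i a y) / Φ.slope i a := by
      unfold DiagIFS.base; field_simp; ring
    have : |(Φ.base i b y' - Φ.base i a y) / Φ.slope i a| < endDist y := by
      rw [abs_div, div_lt_iff₀ (abs_pos.2 hs), abs_sub_comm, mul_comm]; exact hlt
    rw [abs_lt] at this
    have m1 := min_le_left y (1 - y)
    have m2 := min_le_right y (1 - y)
    rw [e]
    unfold endDist at this
    constructor <;> linarith [this.1, this.2]
  have hcl : y' ∈ closure (Ioo (0 : ℝ) 1) := by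
    rw [closure_Ioo (by norm_num)]; exact hy'
  obtain ⟨t, ht1, ht2⟩ := mem_closure_iff.1 hcl _ (isOpen_Ioo.preimage hcont) hmem
  refine Set.disjoint_left.1 (hB i a b hab) ⟨_, ht1, ?_⟩ ⟨t, ht2, rfl⟩
  simp only [DiagIFS.base]; field_simp; ring

theorem endDist_le_abs_code_sub (hV : Φ.Valid) (hB : Φ.Baranski) (i : Fin d)
    (w w' : ℕ → A i) {k m : ℕ} (hkm : k < m) (h : ∀ l < k, w l = w' l) (hk : w k ≠ w' k) :
    Real.exp (-∑ l ∈ Finset.range m, Φ.lyap i (w l)) * endDist (Φ.code i fun l => w (l + m))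
      ≤ |Φ.code i w - Φ.code i w'| := by
  have step : ∀ m, k + 1 ≤ m →
      Real.exp (-∑ l ∈ Finset.range m, Φ.lyap i (w l)) * endDist (Φ.code i fun l => w (l + m))
      ≤ Real.exp (-∑ l ∈ Finset.range (k + 1), Φ.lyap i (w l)) *
        endDist (Φ.code i fun l => w (l + (k + 1))) := by
    intro m hm
    induction m, hm using Nat.le_induction with
    | base => exact le_rfl
    | succ m _ ih =>
      refine le_trans ?_ ih
      rw [Finset.sum_range_succ, neg_add, Real.exp_add, mul_assoc, hV.exp_neg_lyap]
      refine mul_le_mul_of_nonneg_left ?_ (Real.exp_pos _).le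
      rw [hV.code_eq_base i fun l => w (l + m)]
      simp only [zero_add, add_assoc, add_comm 1 m]
      exact le_endDist_base hV i _ (hV.code_mem i _)
  refine (step m hkm).trans ?_
  rw [hV.code_sub i k w w' h, abs_mul, hV.prod_eq, Finset.sum_range_succ, neg_add, Real.exp_add,
    mul_assoc, hV.exp_neg_lyap]
  refine mul_le_mul_of_nonneg_left ?_ (Real.exp_pos _).le
  rw [hV.code_eq_base i fun l => w (l + k), hV.code_eq_base i fun l => w' (l + k)]
  simp only [zero_add, add_assoc, add_comm 1 k]
  exact endDist_le_abs_base_sub hV hB i hk (hV.code_mem i _)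

theorem base_mem_image_Ioo (hV : Φ.Valid) (i : Fin d) (a : A i) {z : ℝ}
    (hz : z ∈ Ioo (min (Φ.off i a) (Φ.off i a + Φ.slope i a))
      (max (Φ.off i a) (Φ.off i a + Φ.slope i a))) :
    z ∈ Φ.base i a '' Ioo (0 : ℝ) 1 := by
  have hs : Φ.slope i a ≠ 0 := hV.2.1 i a
  refine ⟨(z - Φ.off i a) / Φ.slope i a, ?_, by unfold DiagIFS.base; field_simp; ring⟩
  rcases lt_or_gt_of_ne hs with h | h
  · rw [min_eq_right (by linarith), max_eq_left (by linarith)] at hz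
    exact ⟨div_pos_of_neg_of_neg (by linarith [hz.2]) h, by
      rw [div_lt_one_of_neg h]; linarith [hz.1]⟩
  · rw [min_eq_left (by linarith), max_eq_right (by linarith)] at hz
    exact ⟨div_pos (by linarith [hz.1]) h, by rw [div_lt_one h]; linarith [hz.2]⟩

theorem exists_word_endDist (hV : Φ.Valid) (hB : Φ.Baranski) (i : Fin d) {a b : A i}
    (hab : a ≠ b) :
    ∃ a' b' : A i, (a' = a ∨ a' = b) ∧ (b' = a ∨ b' = b) ∧
      ∃ c > 0, ∀ y ∈ Icc (0 : ℝ) 1, c ≤ endDist (Φ.base i a' (Φ.base i b' y)) := by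
  have key : ∀ a b : A i, max (Φ.off i a) (Φ.off i a + Φ.slope i a)
      ≤ min (Φ.off i b) (Φ.off i b + Φ.slope i b) →
      ∃ b' : A i, (b' = a ∨ b' = b) ∧
      ∃ c > 0, ∀ y ∈ Icc (0 : ℝ) 1, c ≤ endDist (Φ.base i a (Φ.base i b' y)) := by
    intro a b hle
    have ha := hV.2.1 i a
    have hb := hV.2.1 i b
    have a0 := hV.2.2.2 i a 0 (by simp)
    have a1 := hV.2.2.2 i a 1 (by simp)
    have b0 := hV.2.2.2 i b 0 (by simp)
    have b1 := hV.2.2.2 i b 1 (by simp)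
    unfold DiagIFS.base at a0 a1 b0 b1
    simp only [mul_zero, zero_add, mul_one, mem_Icc] at a0 a1 b0 b1
    have hpa := abs_pos.2 ha
    have hpb := abs_pos.2 hb
    simp only [le_min_iff, max_le_iff] at hle
    obtain ⟨⟨l1, l2⟩, l3, l4⟩ := hle
    have hb_le : ∀ y ∈ Icc (0 : ℝ) 1, Φ.base i a y ≤ 1 - |Φ.slope i b| := by
      rintro y ⟨y0, y1⟩
      unfold DiagIFS.base
      rcases abs_cases (Φ.slope i b) with ⟨e, h⟩ | ⟨e, h⟩ <;> rw [e] <;> nlinarith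
    rcases lt_or_gt_of_ne ha with h | h
    · refine ⟨a, Or.inl rfl, |Φ.slope i a| * |Φ.slope i b| , mul_pos hpa hpb, fun y hy => ?_⟩
      have h2 := hb_le y hy
      have h3 := hb_le _ (hV.2.2.2 i a y hy)
      have h4 := hV.2.2.2 i a y hy
      have h5 : |Φ.slope i a| < 1 := hV.2.2.1 i a
      set z := Φ.base i a y
      refine le_min ?_ (by nlinarith)
      rw [abs_of_neg h]
      unfold DiagIFS.base
      nlinarith
    · refine ⟨b, Or.inr rfl, |Φ.slope i a| * min |Φ.slope i a| |Φ.slope i b|,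
        mul_pos hpa (lt_min hpa hpb), fun y hy => ?_⟩
      have h3 := hb_le _ (hV.2.2.2 i b y hy)
      have h4 := hV.2.2.2 i b y hy
      have h5 : |Φ.slope i a| < 1 := hV.2.2.1 i a
      have h6 : Φ.slope i a ≤ Φ.base i b y := by
        obtain ⟨y0, y1⟩ := hy
        unfold DiagIFS.base; nlinarith
      have h7 := min_le_left |Φ.slope i a| |Φ.slope i b|
      have h8 := min_le_right |Φ.slope i a| |Φ.slope i b|
      have h9 : 0 < min |Φ.slope i a| |Φ.slope i b| := lt_min hpa hpb
      set z := Φ.base i b y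
      set m := min |Φ.slope i a| |Φ.slope i b|
      refine le_min ?_ (by nlinarith)
      rw [abs_of_pos h] at *
      unfold DiagIFS.base
      nlinarith
  have hdis : Disjoint (Ioo (min (Φ.off i a) (Φ.off i a + Φ.slope i a))
      (max (Φ.off i a) (Φ.off i a + Φ.slope i a)))
      (Ioo (min (Φ.off i b) (Φ.off i b + Φ.slope i b))
      (max (Φ.off i b) (Φ.off i b + Φ.slope i b))) :=
    (hB i a b hab).mono (fun _ => base_mem_image_Ioo hV i a) (fun _ => base_mem_image_Ioo hV i b)
  rw [Set.Ioo_disjoint_Ioo] at hdis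
  have hlt : ∀ a : A i, min (Φ.off i a) (Φ.off i a + Φ.slope i a)
      < max (Φ.off i a) (Φ.off i a + Φ.slope i a) := fun a =>
    min_lt_max.2 (by simpa using (hV.2.1 i a))
  have ha := hlt a
  have hb := hlt b
  have : max (Φ.off i a) (Φ.off i a + Φ.slope i a)
      ≤ min (Φ.off i b) (Φ.off i b + Φ.slope i b) ∨
      max (Φ.off i b) (Φ.off i b + Φ.slope i b)
      ≤ min (Φ.off i a) (Φ.off i a + Φ.slope i a) := by
    by_contra! hh
    refine absurd hdis (not_le.2 ?_)
    rw [lt_min_iff, max_lt_iff, max_lt_iff]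
    exact ⟨⟨ha, hh.1⟩, hh.2, hb⟩
  rcases this with h | h
  · obtain ⟨b', hb', hc⟩ := key a b h
    exact ⟨a, b', Or.inl rfl, hb', hc⟩
  · obtain ⟨b', hb', hc⟩ := key b a h
    exact ⟨b, b', Or.inr rfl, hb'.symm, hc⟩

end Separation

section MassDistribution

variable {X : Type*} [MetricSpace X] [MeasurableSpace X] [BorelSpace X]

/-- Mass distribution principle: uniform upper bounds for the masses of balls centred on a set of
positive mass bound the Hausdorff dimension of that set from below. -/
theorem le_dimH_of_measure_ball_le (ν : Measure X) [IsFiniteMeasure ν] (F : Set X) {t : ℝ≥0}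
    (ht : 0 < t) {ρ₀ : ℝ} (hρ₀ : 0 < ρ₀)
    (hF : ∀ x ∈ F, ∀ ρ ∈ Ioo 0 ρ₀, ν (ball x ρ) ≤ ENNReal.ofReal (ρ ^ (t : ℝ)))
    (hν : ν F ≠ 0) : (t : ℝ≥0∞) ≤ dimH F := by
  apply le_dimH_of_hausdorffMeasure_ne_zero
  have ht' : (0 : ℝ) < t := ht
  have hle : ENNReal.ofReal (2 ^ (-(t : ℝ))) • ν.restrict F ≤ μH[(t : ℝ)] := by
    refine Measure.le_hausdorffMeasure _ _ (ENNReal.ofReal (ρ₀ / 4)) (by positivity) ?_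
    intro s hs
    rw [Measure.smul_apply, smul_eq_mul]
    have h1 : ν.restrict F s ≤ ν (closure s ∩ F) :=
      (measure_mono subset_closure).trans
        (Measure.restrict_apply isClosed_closure.measurableSet).le
    rcases (closure s ∩ F).eq_empty_or_nonempty with he | ⟨x, hx, hxF⟩
    · rw [he, measure_empty] at h1
      rw [nonpos_iff_eq_zero.1 h1, mul_zero]; exact zero_le
    have hne : ediam s ≠ ∞ := ne_top_of_le_ne_top ENNReal.ofReal_ne_top hs
    have hsD : ediam s = ENNReal.ofReal (ediam s).toReal := (ENNReal.ofReal_toReal hne).symm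
    set D := (ediam s).toReal with hD
    have hD0 : 0 ≤ D := ENNReal.toReal_nonneg
    have hDρ : D ≤ ρ₀ / 4 := by
      rw [hsD] at hs
      exact (ENNReal.ofReal_le_ofReal_iff (by positivity)).1 hs
    have hball : ∀ ρ ∈ Ioo D ρ₀, ν.restrict F s ≤ ENNReal.ofReal (ρ ^ (t : ℝ)) := by
      intro ρ hρ
      refine h1.trans ((measure_mono ?_).trans (hF x hxF ρ ⟨hD0.trans_lt hρ.1, hρ.2⟩))
      rintro y ⟨hy, -⟩
      have : edist y x ≤ ediam s := by
        rw [← ediam_closure]; exact edist_le_ediam_of_mem hy hx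
      rw [hsD, edist_dist] at this
      exact ((ENNReal.ofReal_le_ofReal_iff hD0).1 this).trans_lt hρ.1
    rcases hD0.eq_or_lt with h0 | h0
    · have : ν.restrict F s = 0 := by
        refine le_antisymm (ge_of_tendsto (x := 𝓝[>] (0 : ℝ))
          (f := fun ρ : ℝ => ENNReal.ofReal (ρ ^ (t : ℝ))) ?_ ?_) zero_le
        · have : Tendsto (fun ρ : ℝ => ENNReal.ofReal (ρ ^ (t : ℝ))) (𝓝 0)
              (𝓝 (ENNReal.ofReal ((0 : ℝ) ^ (t : ℝ)))) :=
            (ENNReal.continuous_ofReal.comp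
              (Real.continuous_rpow_const ht'.le)).tendsto 0
          rw [Real.zero_rpow ht'.ne', ENNReal.ofReal_zero] at this
          exact this.mono_left nhdsWithin_le_nhds
        · filter_upwards [Ioo_mem_nhdsGT hρ₀] with ρ hρ
          exact hball ρ ⟨h0 ▸ hρ.1, hρ.2⟩
      rw [this, mul_zero]; exact zero_le
    · have h2 := hball (2 * D) ⟨by linarith, by linarith⟩
      refine (mul_le_mul_right h2 _).trans (le_of_eq ?_)
      rw [hsD, ← ENNReal.ofReal_mul (by positivity), ENNReal.ofReal_rpow_of_pos h0,
        Real.mul_rpow (by norm_num) h0.le, ← mul_assoc, ← Real.rpow_add (by norm_num)]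
      simp
  intro h0
  have := hle F
  rw [h0, Measure.smul_apply, Measure.restrict_apply_self, smul_eq_mul, nonpos_iff_eq_zero,
    mul_eq_zero] at this
  rcases this with h | h
  · rw [ENNReal.ofReal_eq_zero] at h
    have : (0 : ℝ) < 2 ^ (-(t : ℝ)) := by positivity
    linarith
  · exact hν h

theorem measDim_le_dimH (ν : Measure X) [IsProbabilityMeasure ν] (S : Set X)
    (hS : ∀ᵐ x ∂ν, x ∈ S) : measDim ν ≤ dimH S := by
  by_contra! hlt
  obtain ⟨t, ht1, ht2⟩ := ENNReal.lt_iff_exists_nnreal_btwn.1 hlt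
  have htpos : 0 < t := by exact_mod_cast pos_of_gt ht1
  have htpos' : (0 : ℝ) < t := htpos
  set F : ℕ → Set X := fun n => {x | x ∈ S ∧ ∀ ρ ∈ Ioo (0 : ℝ) (1 / ((n : ℝ) + 2)),
    ν (ball x ρ) ≤ ENNReal.ofReal (ρ ^ (t : ℝ))} with hF
  have hnull : ∀ n, ν (F n) = 0 := by
    intro n
    by_contra hne
    have h1 := le_dimH_of_measure_ball_le ν (F n) htpos
      (ρ₀ := 1 / ((n : ℝ) + 2)) (by positivity) (fun x hx => hx.2) hne
    exact absurd (h1.trans (dimH_mono fun x hx => hx.1)) (not_le.2 ht1)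
  refine absurd ht2 (not_lt.2 (essSup_le_of_ae_le _ ?_))
  have hall : ∀ᵐ x ∂ν, ∀ n, x ∉ F n := ae_all_iff.2 fun n => measure_eq_zero_iff_ae_notMem.1 (hnull n)
  filter_upwards [hall, hS] with x hx hxS
  by_contra! hlt'
  have hev := eventually_lt_of_lt_liminf hlt'
  obtain ⟨u, hu, hu2⟩ := (mem_nhdsGT_iff_exists_Ioo_subset).1 hev
  obtain ⟨n, hn⟩ := exists_nat_one_div_lt (show (0 : ℝ) < u from hu)
  refine hx n ⟨hxS, fun ρ hρ => ?_⟩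
  have hn2 : 1 / ((n : ℝ) + 2) ≤ 1 / ((n : ℝ) + 1) := by
    apply one_div_le_one_div_of_le <;> linarith [Nat.cast_nonneg (α := ℝ) n]
  have hρu : ρ ∈ Ioo 0 u := ⟨hρ.1, by linarith [hρ.2]⟩
  have hρ1 : ρ < 1 := by
    have : 1 / ((n : ℝ) + 2) < 1 := by
      rw [div_lt_one] <;> linarith [Nat.cast_nonneg (α := ℝ) n]
    linarith [hρ.2]
  have hlog : Real.log ρ < 0 := Real.log_neg hρ.1 hρ1
  have h3 : (t : ℝ≥0∞) < ENNReal.ofReal (Real.log (ν (ball x ρ)).toReal / Real.log ρ) := hu2 hρu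
  have h4 : (t : ℝ) < Real.log (ν (ball x ρ)).toReal / Real.log ρ := by
    rw [← ENNReal.ofReal_coe_nnreal] at h3
    exact (ENNReal.ofReal_lt_ofReal_iff_of_nonneg t.2).1 h3
  rw [lt_div_iff_of_neg hlog] at h4
  rw [← ENNReal.ofReal_toReal (measure_ne_top ν (ball x ρ))]
  refine ENNReal.ofReal_le_ofReal ?_
  rcases (ENNReal.toReal_nonneg (a := ν (ball x ρ))).eq_or_lt with h0 | h0
  · rw [← h0]; exact (Real.rpow_pos_of_pos hρ.1 _).le
  · rw [← Real.log_le_log_iff h0 (Real.rpow_pos_of_pos hρ.1 _), Real.log_rpow hρ.1]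
    exact h4.le

end MassDistribution

section LargeNumbers

open ProbabilityTheory

variable {α : Type*} [MeasurableSpace α] (P : Measure α) [IsProbabilityMeasure P]

theorem identDistrib_eval (i j : ℕ) :
    IdentDistrib (fun ω : ℕ → α => ω i) (fun ω : ℕ → α => ω j)
      (Measure.infinitePi fun _ : ℕ => P) (Measure.infinitePi fun _ : ℕ => P) where
  aemeasurable_fst := (measurable_pi_apply i).aemeasurable
  aemeasurable_snd := (measurable_pi_apply j).aemeasurable
  map_eq := by rw [Measure.infinitePi_map_eval, Measure.infinitePi_map_eval]

theorem iIndepFun_eval :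
    iIndepFun (fun (i : ℕ) (ω : ℕ → α) => ω i) (Measure.infinitePi fun _ : ℕ => P) :=
  iIndepFun_infinitePi (P := fun _ : ℕ => P) (X := fun _ x => x) fun _ => measurable_id

variable [DiscreteMeasurableSpace α]

theorem ae_tendsto_average [Fintype α] (f : α → ℝ) :
    ∀ᵐ ω ∂(Measure.infinitePi fun _ : ℕ => P),
      Tendsto (fun n : ℕ => (∑ k ∈ Finset.range n, f (ω k)) / n) atTop
        (𝓝 (∑ a, P.real {a} * f a)) := by
  have hf : Measurable f := Measurable.of_discrete
  have hint : Integrable f P := Integrable.of_finite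
  have hmp := measurePreserving_eval_infinitePi (fun _ : ℕ => P) 0
  have h := strong_law_ae_real (μ := Measure.infinitePi fun _ : ℕ => P)
    (fun k ω => f (ω k)) (hmp.integrable_comp_of_integrable hint)
    (fun i j hij => ((iIndepFun_eval P).indepFun hij).comp hf hf)
    (fun i => (identDistrib_eval P i 0).comp hf)
  have he : ∫ ω, f (ω 0) ∂(Measure.infinitePi fun _ : ℕ => P) = ∑ a, P.real {a} * f a := by
    rw [← hmp.map_eq] at hint
    have := integral_map (μ := Measure.infinitePi fun _ : ℕ => P) (φ := fun ω => ω 0)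
      (measurable_pi_apply 0).aemeasurable hf.aestronglyMeasurable
    rw [← this, Measure.infinitePi_map_eval, integral_fintype Integrable.of_finite]
    simp
  simp only [he] at h
  exact h

theorem ae_tendsto_pair_average (S T : Set α) :
    ∀ᵐ ω ∂(Measure.infinitePi fun _ : ℕ => P),
      Tendsto (fun n : ℕ => (∑ k ∈ Finset.range n,
        if ω (2 * k) ∈ S ∧ ω (2 * k + 1) ∈ T then (1 : ℝ) else 0) / n) atTop
        (𝓝 (P.real S * P.real T)) := by
  set g : α × α → ℝ := fun x => if x.1 ∈ S ∧ x.2 ∈ T then (1 : ℝ) else 0 with hg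
  have hST : MeasurableSet (S ×ˢ T) :=
    (MeasurableSet.of_discrete (s := S)).prod (MeasurableSet.of_discrete (s := T))
  have hg' : g = (S ×ˢ T).indicator fun _ => (1 : ℝ) := by
    ext x; simp [hg, Set.indicator_apply, Set.mem_prod]
  have hgm : Measurable g := by rw [hg']; exact measurable_const.indicator hST
  have hpm : ∀ k, Measurable fun ω : ℕ → α => (ω (2 * k), ω (2 * k + 1)) := fun k => by fun_prop
  have hint : Integrable (fun ω : ℕ → α => g (ω (2 * 0), ω (2 * 0 + 1)))
      (Measure.infinitePi fun _ : ℕ => P) := by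
    refine Integrable.of_bound (hgm.comp (hpm 0)).aestronglyMeasurable 1 (ae_of_all _ fun ω => ?_)
    simp only [hg]; split_ifs <;> simp
  have hi : ∀ k l : ℕ, k ≠ l → IndepFun (fun ω : ℕ → α => ω k) (fun ω => ω l)
      (Measure.infinitePi fun _ : ℕ => P) := fun k l h => (iIndepFun_eval P).indepFun h
  have h := strong_law_ae_real (μ := Measure.infinitePi fun _ : ℕ => P)
    (fun k ω => g (ω (2 * k), ω (2 * k + 1))) hint
    (fun i j hij => ((iIndepFun_eval P).indepFun_prodMk_prodMk (fun i => measurable_pi_apply i)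
      (2 * i) (2 * i + 1) (2 * j) (2 * j + 1) (by omega) (by omega) (by omega) (by omega)).comp
      hgm hgm)
    (fun i => (IdentDistrib.prodMk (identDistrib_eval P (2 * i) (2 * 0))
      (identDistrib_eval P (2 * i + 1) (2 * 0 + 1)) (hi _ _ (by omega)) (hi _ _ (by omega))).comp
      hgm)
  have he : ∫ ω : ℕ → α, g (ω (2 * 0), ω (2 * 0 + 1)) ∂(Measure.infinitePi fun _ : ℕ => P)
      = P.real S * P.real T := by
    have hset : (fun ω : ℕ → α => g (ω (2 * 0), ω (2 * 0 + 1)))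
        = ((fun ω : ℕ → α => (ω 0, ω 1)) ⁻¹' (S ×ˢ T)).indicator 1 := by
      ext ω; rw [hg']; simp [Set.indicator_apply]
    have h1 : (fun ω : ℕ → α => (ω 0, ω 1)) ⁻¹' (S ×ˢ T)
        = Set.pi (({0, 1} : Finset ℕ) : Set ℕ) (fun k => if k = 0 then S else T) := by
      ext ω; simp
    rw [hset, integral_indicator_one (((hpm 0) hST)), h1, measureReal_def,
      Measure.infinitePi_pi _ fun _ _ => MeasurableSet.of_discrete]
    simp [measureReal_def]
  simp only [he] at h
  exact h

theorem eventually_exists_ne_zero_of_average {x : ℕ → ℝ} {q θ : ℝ} (hq : 0 < q) (hθ : 0 < θ)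
    (hx : Tendsto (fun n : ℕ => (∑ k ∈ Finset.range n, x k) / n) atTop (𝓝 q)) :
    ∀ᶠ n : ℕ in atTop, ∃ l : ℕ, n ≤ l ∧ (l : ℝ) < (1 + θ) * n ∧ x l ≠ 0 := by
  set ε := q * θ / (2 * (3 + θ)) with hε
  have hεpos : 0 < ε := by positivity
  obtain ⟨N, hN⟩ := eventually_atTop.1 ((Metric.tendsto_nhds.1 hx) ε hεpos)
  filter_upwards [eventually_ge_atTop (max N 1)] with n hn
  have hnN : N ≤ n := (le_max_left _ _).trans hn
  have hn1 : 1 ≤ n := (le_max_right _ _).trans hn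
  have hn1' : (1 : ℝ) ≤ n := by exact_mod_cast hn1
  set n' := ⌈(1 + θ) * n⌉₊ with hn'
  have hle : (1 + θ) * n ≤ n' := Nat.le_ceil _
  have hlt : (n' : ℝ) < (1 + θ) * n + 1 := Nat.ceil_lt_add_one (by positivity)
  have hnn' : n ≤ n' := by
    have : (n : ℝ) ≤ n' := by nlinarith
    exact_mod_cast this
  by_contra! hcon
  have hsum : ∑ k ∈ Finset.range n', x k = ∑ k ∈ Finset.range n, x k := by
    symm
    refine Finset.sum_subset (Finset.range_subset_range.2 hnn') fun l hl hl' => ?_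
    simp only [Finset.mem_range, not_lt] at hl hl'
    exact hcon l hl' (Nat.lt_ceil.1 hl)
  have key : ∀ m, N ≤ m → 1 ≤ m →
      |∑ k ∈ Finset.range m, x k - q * m| ≤ ε * m := by
    intro m hm hm1
    have hm0 : (0 : ℝ) < m := by exact_mod_cast hm1
    have := hN m hm
    rw [Real.dist_eq] at this
    have e : ∑ k ∈ Finset.range m, x k - q * m = ((∑ k ∈ Finset.range m, x k) / m - q) * m := by
      field_simp
    rw [e, abs_mul, abs_of_pos hm0]
    exact mul_le_mul_of_nonneg_right this.le hm0.le
  have k1 := abs_le.1 (key n hnN hn1)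
  have k2 := abs_le.1 (key n' (hnN.trans hnn') (hn1.trans hnn'))
  rw [hsum] at k2
  have h1 : q * (n' - n) ≤ ε * (n + n') := by linarith [k1.2, k2.1]
  have h2 : q * (θ * n) ≤ q * (n' - n) := mul_le_mul_of_nonneg_left (by linarith) hq.le
  have h3 : ε * (n + n') ≤ ε * ((3 + θ) * n) := mul_le_mul_of_nonneg_left (by linarith) hεpos.le
  have h4 : ε * ((3 + θ) * n) = q * θ * n / 2 := by rw [hε]; field_simp
  have : 0 < q * θ * n := by positivity
  nlinarith

theorem ae_eventually_exists_word {S T : Set α} (hS : 0 < P.real S) (hT : 0 < P.real T) {θ : ℝ}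
    (hθ : 0 < θ) :
    ∀ᵐ ω ∂(Measure.infinitePi fun _ : ℕ => P), ∀ᶠ n : ℕ in atTop,
      ∃ m : ℕ, n ≤ m ∧ (m : ℝ) ≤ (1 + θ) * n ∧ ω m ∈ S ∧ ω (m + 1) ∈ T := by
  filter_upwards [ae_tendsto_pair_average P S T] with ω hω
  have h := eventually_exists_ne_zero_of_average (mul_pos hS hT) (half_pos hθ) hω
  have ht : Tendsto (fun n : ℕ => (n + 1) / 2) atTop atTop :=
    tendsto_atTop_atTop.2 fun b => ⟨2 * b, fun a ha => by omega⟩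
  obtain ⟨M, hM⟩ := exists_nat_gt ((1 + θ / 2) / (θ / 2))
  filter_upwards [ht.eventually h, eventually_ge_atTop M] with n hn hnM
  obtain ⟨l, hl1, hl2, hl3⟩ := hn
  refine ⟨2 * l, by omega, ?_, ?_⟩
  · have h1 : (((n + 1) / 2 : ℕ) : ℝ) * 2 ≤ n + 1 := by
      exact_mod_cast Nat.div_mul_le_self (n + 1) 2
    have h2 : (1 + θ / 2) ≤ θ / 2 * n := by
      have : (1 + θ / 2) / (θ / 2) ≤ n := hM.le.trans (by exact_mod_cast hnM)
      rw [div_le_iff₀ (by positivity)] at this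
      linarith
    push_cast
    nlinarith
  · by_contra hne
    exact hl3 (if_neg hne)

end LargeNumbers

section Bernoulli

variable {Φ : DiagIFS d A}

/-- The measure on the alphabet with density `p`. -/
noncomputable def letterMeasure (p : Φ.Symb → ℝ) : Measure Φ.Symb :=
  ∑ a, ENNReal.ofReal (p a) • Measure.dirac a

theorem letterMeasure_apply {p : Φ.Symb → ℝ} (hp : ∀ a, 0 ≤ p a) (S : Set Φ.Symb) :
    letterMeasure p S = ENNReal.ofReal (∑ a, if a ∈ S then p a else 0) := by
  rw [letterMeasure, Measure.finsetSum_apply, ENNReal.ofReal_sum_of_nonneg]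
  · refine Finset.sum_congr rfl fun a _ => ?_
    rw [Measure.smul_apply, Measure.dirac_apply' _ MeasurableSet.of_discrete]
    by_cases h : a ∈ S <;> simp [h]
  · intro a _; split_ifs <;> simp [hp a]

theorem isProbabilityMeasure_letterMeasure {p : Φ.Symb → ℝ} (hp : IsProbVec p) :
    IsProbabilityMeasure (letterMeasure p) :=
  ⟨by
    rw [letterMeasure_apply hp.1]
    simp only [mem_univ, if_true]
    rw [hp.2, ENNReal.ofReal_one]⟩

theorem letterMeasure_singleton {p : Φ.Symb → ℝ} (hp : ∀ a, 0 ≤ p a) (a : Φ.Symb) :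
    letterMeasure p {a} = ENNReal.ofReal (p a) := by
  rw [letterMeasure_apply hp]; simp

theorem letterMeasure_real_singleton {p : Φ.Symb → ℝ} (hp : ∀ a, 0 ≤ p a) (a : Φ.Symb) :
    (letterMeasure p).real {a} = p a := by
  rw [measureReal_def, letterMeasure_singleton hp, ENNReal.toReal_ofReal (hp a)]

/-- The product measure `p^ℕ` on `E^ℕ`. -/
noncomputable def bernoulli (p : Φ.Symb → ℝ) : Measure (ℕ → Φ.Symb) :=
  Measure.infinitePi fun _ : ℕ => letterMeasure p

theorem isProbabilityMeasure_bernoulli {p : Φ.Symb → ℝ} (hp : IsProbVec p) :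
    IsProbabilityMeasure (bernoulli p) := by
  have := isProbabilityMeasure_letterMeasure hp
  unfold bernoulli; infer_instance

theorem bernoulli_pi {p : Φ.Symb → ℝ} (hp : IsProbVec p) (n : ℕ) (t : ℕ → Set Φ.Symb) :
    bernoulli p {ω | ∀ k < n, ω k ∈ t k} = ∏ k ∈ Finset.range n, letterMeasure p (t k) := by
  have := isProbabilityMeasure_letterMeasure hp
  rw [← Measure.infinitePi_pi (μ := fun _ : ℕ => letterMeasure p)
    fun _ _ => MeasurableSet.of_discrete]
  congr 1
  ext ω; simp

theorem isProductMeasure_bernoulli {p : Φ.Symb → ℝ} (hp : IsProbVec p) :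
    IsProductMeasure Φ (fun _ => p) (bernoulli p) := by
  refine ⟨isProbabilityMeasure_bernoulli hp, fun n w => ?_⟩
  have h := bernoulli_pi hp n fun k => {w k}
  simp only [mem_singleton_iff] at h
  rw [h, ENNReal.toReal_prod]
  refine Finset.prod_congr rfl fun k _ => ?_
  rw [letterMeasure_singleton hp.1, ENNReal.toReal_ofReal (hp.1 _)]

theorem bernoulli_ae_tendsto {p : Φ.Symb → ℝ} (hp : IsProbVec p) (f : Φ.Symb → ℝ) :
    ∀ᵐ ω ∂(bernoulli p), Tendsto (fun n : ℕ => (∑ k ∈ Finset.range n, f (ω k)) / n) atTop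
        (𝓝 (∑ a, p a * f a)) := by
  have := isProbabilityMeasure_letterMeasure hp
  have h := ae_tendsto_average (letterMeasure p) f
  simp only [letterMeasure_real_singleton hp.1] at h
  exact h

theorem bernoulli_ae_pos {p : Φ.Symb → ℝ} (hp : IsProbVec p) :
    ∀ᵐ ω ∂(bernoulli p), ∀ k, 0 < p (ω k) := by
  have := isProbabilityMeasure_letterMeasure hp
  refine ae_all_iff.2 fun k => ?_
  have h : ∀ᵐ a ∂(letterMeasure p), 0 < p a := by
    rw [ae_iff, letterMeasure_apply hp.1, ENNReal.ofReal_eq_zero]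
    refine (Finset.sum_eq_zero fun a _ => ?_).le
    split_ifs with h
    · exact le_antisymm (not_lt.1 h) (hp.1 a)
    · rfl
  exact (measurePreserving_eval_infinitePi (fun _ : ℕ => letterMeasure p) k).quasiMeasurePreserving.ae h

theorem chi_eq_sum (i : Fin d) (p : Φ.Symb → ℝ) :
    Φ.chi i p = ∑ a : Φ.Symb, p a * Φ.lyap i (a.1 i) := by
  unfold DiagIFS.chi DiagIFS.lyap
  rw [← Finset.sum_neg_distrib]
  exact Finset.sum_congr rfl fun a _ => by ring

theorem chi_pos (hV : Φ.Valid) (i : Fin d) {p : Φ.Symb → ℝ} (hp : IsProbVec p) :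
    0 < Φ.chi i p := by
  rw [chi_eq_sum]
  obtain ⟨c, C, hc, -, h⟩ := hV.exists_lyap_bounds
  refine hc.trans_le ?_
  calc c = ∑ a : Φ.Symb, p a * c := by rw [← Finset.sum_mul, hp.2, one_mul]
    _ ≤ _ := Finset.sum_le_sum fun a _ => mul_le_mul_of_nonneg_left (h i _).1 (hp.1 a)

theorem bernoulli_ae_separation (hV : Φ.Valid) (hB : Φ.Baranski) (i : Fin d)
    {p : Φ.Symb → ℝ} (hp : IsProbVec p) {ε : ℝ} (hε : 0 < ε) :
    ∀ᵐ ω ∂(bernoulli p), ∀ᶠ n : ℕ in atTop, ∀ ω' : ℕ → Φ.Symb, (∀ k, 0 < p (ω' k)) →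
      |Φ.coding ω i - Φ.coding ω' i| < Real.exp (-(n * (Φ.chi i p + ε))) →
      ∀ k < n, (ω' k).1 i = (ω k).1 i := by
  have := isProbabilityMeasure_letterMeasure hp
  have hχ := chi_pos hV i hp
  by_cases hex : ∃ α β : Φ.Symb, 0 < p α ∧ 0 < p β ∧ α.1 i ≠ β.1 i
  swap
  · push Not at hex
    filter_upwards [bernoulli_ae_pos hp] with ω hω
    exact Eventually.of_forall fun n ω' hω' _ k _ => hex _ _ (hω' k) (hω k)
  obtain ⟨α, β, hα, hβ, hαβ⟩ := hex
  obtain ⟨a', b', ha', hb', c, hc, hcb⟩ := exists_word_endDist hV hB i hαβ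
  have hpos : ∀ a : A i, (a = α.1 i ∨ a = β.1 i) →
      0 < (letterMeasure p).real {x : Φ.Symb | x.1 i = a} := by
    have aux : ∀ γ : Φ.Symb, 0 < p γ → 0 < (letterMeasure p).real {x : Φ.Symb | x.1 i = γ.1 i} := by
      intro γ hγ
      refine lt_of_lt_of_le ?_ (measureReal_mono (s₁ := {γ}) (by simp))
      rwa [letterMeasure_real_singleton hp.1]
    rintro a (rfl | rfl)
    · exact aux _ hα
    · exact aux _ hβ
  set θ := (ε / 4) / (Φ.chi i p + ε / 4) with hθ
  have hθpos : 0 < θ := by positivity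
  have hword := ae_eventually_exists_word (letterMeasure p) (hpos a' ha') (hpos b' hb') hθpos
  filter_upwards [hword, bernoulli_ae_tendsto hp fun a => Φ.lyap i (a.1 i)] with ω h1 h2
  rw [← chi_eq_sum] at h2
  have h3 : ∀ᶠ n : ℕ in atTop, ∑ k ∈ Finset.range n, Φ.lyap i ((ω k).1 i)
      ≤ (Φ.chi i p + ε / 4) * n := by
    filter_upwards [h2.eventually (gt_mem_nhds (show Φ.chi i p < Φ.chi i p + ε / 4 by linarith)),
      eventually_gt_atTop 0] with n hn hn0
    have : (0 : ℝ) < n := by exact_mod_cast hn0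
    rw [div_lt_iff₀ this] at hn
    exact hn.le
  have h4 : ∀ᶠ n : ℕ in atTop, Real.exp (-(n * (ε / 2))) < c := by
    have : Tendsto (fun n : ℕ => Real.exp (-(n * (ε / 2)))) atTop (𝓝 0) := by
      refine Real.tendsto_exp_neg_atTop_nhds_zero.comp ?_
      exact tendsto_natCast_atTop_atTop.atTop_mul_const (by positivity)
    exact this.eventually (gt_mem_nhds hc)
  obtain ⟨N, hN⟩ := eventually_atTop.1 h3
  filter_upwards [h1, h4, eventually_ge_atTop N] with n hn1 hn4 hnN ω' hω' hlt
  by_contra! hcon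
  have hcon' : ∃ k, k < n ∧ (ω' k).1 i ≠ (ω k).1 i := hcon
  obtain ⟨hk, hkne⟩ := Nat.find_spec hcon'
  set k := Nat.find hcon'
  obtain ⟨m, hnm, hm, hma, hmb⟩ := hn1
  have hagree : ∀ l < k, (ω l).1 i = (ω' l).1 i := by
    intro l hl
    have := Nat.find_min hcon' hl
    push Not at this
    exact (this (hl.trans hk)).symm
  have hsep := endDist_le_abs_code_sub hV hB i (fun k => (ω k).1 i) (fun k => (ω' k).1 i)
    (hk.trans_le hnm) hagree hkne.symm
  have hcm : c ≤ endDist (Φ.code i fun l => (ω (l + m)).1 i) := by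
    rw [hV.code_eq_base, hV.code_eq_base]
    have e1 : (ω (0 + m)).1 i = a' := by rw [zero_add]; exact hma
    have e2 : (ω (0 + 1 + m)).1 i = b' := by rw [zero_add, add_comm]; exact hmb
    rw [e1, e2]
    exact hcb _ (hV.code_mem i _)
  have hS := hN m (hnN.trans hnm)
  have hb1 : (Φ.chi i p + ε / 4) * (1 + θ) = Φ.chi i p + ε / 2 := by
    rw [hθ]; field_simp; ring
  have hb2 : ∑ k ∈ Finset.range m, Φ.lyap i ((ω k).1 i) ≤ n * (Φ.chi i p + ε / 2) := by
    refine hS.trans ?_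
    calc (Φ.chi i p + ε / 4) * m ≤ (Φ.chi i p + ε / 4) * ((1 + θ) * n) := by gcongr
      _ = n * (Φ.chi i p + ε / 2) := by rw [← hb1]; ring
  have hb3 : Real.exp (-(n * (Φ.chi i p + ε / 2))) * c < Real.exp (-(n * (Φ.chi i p + ε))) := by
    refine lt_of_le_of_lt ?_ (hsep.trans_lt hlt)
    exact mul_le_mul (Real.exp_le_exp.2 (neg_le_neg hb2)) hcm hc.le (Real.exp_pos _).le
  have hb4 : Real.exp (-(n * (Φ.chi i p + ε)))
      = Real.exp (-(n * (Φ.chi i p + ε / 2))) * Real.exp (-(n * (ε / 2))) := by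
    rw [← Real.exp_add]; ring_nf
  rw [hb4] at hb3
  exact absurd (lt_of_mul_lt_mul_left hb3 (Real.exp_pos _).le) (not_lt.2 hn4.le)

/-- The `i`-th marginal of a vector on the alphabet. -/
noncomputable def marginal (i : Fin d) (p : Φ.Symb → ℝ) (a : A i) : ℝ :=
  ∑ b : Φ.Symb, if b.1 i = a then p b else 0

theorem marginal_nonneg (i : Fin d) {p : Φ.Symb → ℝ} (hp : ∀ a, 0 ≤ p a) (a : A i) :
    0 ≤ marginal i p a :=
  Finset.sum_nonneg fun b _ => by split_ifs <;> simp [hp b]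

theorem le_marginal (i : Fin d) {p : Φ.Symb → ℝ} (hp : ∀ a, 0 ≤ p a) (b : Φ.Symb) :
    p b ≤ marginal i p (b.1 i) := by
  have := Finset.single_le_sum (f := fun c : Φ.Symb => if c.1 i = b.1 i then p c else 0)
    (fun c _ => by split_ifs <;> simp [hp c]) (Finset.mem_univ b)
  rw [if_pos rfl] at this
  exact this

theorem sum_marginal (i : Fin d) (p : Φ.Symb → ℝ) : ∑ a, marginal i p a = ∑ b, p b := by
  unfold marginal
  rw [Finset.sum_comm]
  simp

/-- The information of the `i`-th digit. -/
noncomputable def infoMarg (i : Fin d) (p : Φ.Symb → ℝ) (a : Φ.Symb) : ℝ :=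
  -Real.log (marginal i p (a.1 i))

/-- The conditional information of a letter given its `i`-th digit. -/
noncomputable def infoCond (i : Fin d) (p : Φ.Symb → ℝ) (a : Φ.Symb) : ℝ :=
  -Real.log (p a / marginal i p (a.1 i))

/-- The entropy of the `i`-th marginal. -/
noncomputable def entMarg (i : Fin d) (p : Φ.Symb → ℝ) : ℝ := ∑ a, p a * infoMarg i p a

/-- The conditional entropy given the `i`-th digit. -/
noncomputable def entCond (i : Fin d) (p : Φ.Symb → ℝ) : ℝ := ∑ a, p a * infoCond i p a

theorem bernoulli_cylinder (hd : ∀ a b : Φ.Symb, ∀ i j : Fin d, i ≠ j → a.1 i = b.1 i →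
      a.1 j = b.1 j → a = b) {i j : Fin d} (hij : i ≠ j) {p : Φ.Symb → ℝ} (hp : IsProbVec p)
    {ω : ℕ → Φ.Symb} (hω : ∀ k, 0 < p (ω k)) {m n : ℕ} (hnm : n ≤ m) :
    bernoulli p {ω' | (∀ k < n, (ω' k).1 j = (ω k).1 j) ∧ ∀ k < m, (ω' k).1 i = (ω k).1 i}
      = ENNReal.ofReal (Real.exp (-(∑ k ∈ Finset.range n, infoCond i p (ω k)
        + ∑ k ∈ Finset.range m, infoMarg i p (ω k)))) := by
  have hm : ∀ k, 0 < marginal i p ((ω k).1 i) := fun k => (hω k).trans_le (le_marginal i hp.1 _)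
  have hset : {ω' : ℕ → Φ.Symb | (∀ k < n, (ω' k).1 j = (ω k).1 j) ∧
        ∀ k < m, (ω' k).1 i = (ω k).1 i}
      = {ω' | ∀ k < m, ω' k ∈ if k < n then {ω k} else {b : Φ.Symb | b.1 i = (ω k).1 i}} := by
    ext ω'
    simp only [mem_ofPred_eq]
    constructor
    · rintro ⟨h1, h2⟩ k hk
      split_ifs with h
      · exact hd _ _ i j hij (h2 k hk) (h1 k h)
      · exact h2 k hk
    · intro h
      refine ⟨fun k hk => ?_, fun k hk => ?_⟩
      · have := h k (hk.trans_le hnm)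
        rw [if_pos hk, mem_singleton_iff] at this
        rw [this]
      · have := h k hk
        split_ifs at this with h'
        · rw [mem_singleton_iff.1 this]
        · exact this
  have hfac : ∀ k, letterMeasure p (if k < n then {ω k} else {b : Φ.Symb | b.1 i = (ω k).1 i})
      = ENNReal.ofReal (Real.exp (-((if k < n then infoCond i p (ω k) else 0)
        + infoMarg i p (ω k)))) := by
    intro k
    unfold infoCond infoMarg
    split_ifs with h
    · rw [letterMeasure_singleton hp.1, ← neg_add, neg_neg, Real.exp_add,
        Real.exp_log (div_pos (hω k) (hm k)), Real.exp_log (hm k), div_mul_cancel₀ _ (hm k).ne']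
    · rw [letterMeasure_apply hp.1, zero_add, neg_neg, Real.exp_log (hm k)]
      rfl
  rw [hset, bernoulli_pi hp, Finset.prod_congr rfl fun k _ => hfac k,
    ← ENNReal.ofReal_prod_of_nonneg fun _ _ => (Real.exp_pos _).le, ← Real.exp_sum,
    Finset.sum_neg_distrib, Finset.sum_add_distrib]
  congr 4
  rw [← Finset.sum_filter]
  refine Finset.sum_congr ?_ fun _ _ => rfl
  ext k; simp only [Finset.mem_filter, Finset.mem_range]; omega

end Bernoulli

section LowerBound

theorem tendsto_floor_sum_div {f : ℕ → ℝ} {L a : ℝ} (ha : 0 < a)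
    (h : Tendsto (fun n : ℕ => (∑ k ∈ Finset.range n, f k) / n) atTop (𝓝 L)) :
    Tendsto (fun B : ℝ => (∑ k ∈ Finset.range ⌊a * B⌋₊, f k) / B) atTop (𝓝 (L * a)) := by
  have hfl : Tendsto (fun B : ℝ => ⌊a * B⌋₊) atTop atTop :=
    tendsto_nat_floor_atTop.comp (tendsto_id.const_mul_atTop ha)
  refine ((h.comp hfl).mul (tendsto_nat_floor_mul_div_atTop ha.le)).congr fun B => ?_
  simp only [Function.comp]
  rcases Nat.eq_zero_or_pos ⌊a * B⌋₊ with h0 | h0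
  · simp [h0]
  · have : (0 : ℝ) < ⌊a * B⌋₊ := by exact_mod_cast h0
    field_simp

theorem le_measDim_map {Ω X : Type*} [MeasurableSpace Ω] [PseudoMetricSpace X] [MeasurableSpace X]
    {μ : Measure Ω} [IsProbabilityMeasure μ] {g : Ω → X} (hg : Measurable g) {c : ℝ≥0∞}
    (h : ∀ᵐ ω ∂μ, c ≤ lowerPtDim (μ.map g) (g ω)) : c ≤ measDim (μ.map g) := by
  unfold measDim essSup
  rw [limsup_eq]
  refine le_sInf fun a ha => ?_
  have h2 := ae_of_ae_map hg.aemeasurable ha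
  obtain ⟨ω, h1, h2⟩ := (h.and h2).exists
  exact h1.trans h2

variable {Φ : DiagIFS d A}

theorem bernoulli_ae_le_lowerPtDim (hV : Φ.Valid) (hB : Φ.Baranski)
    (hd : ∀ a b : Φ.Symb, ∀ i j : Fin d, i ≠ j → a.1 i = b.1 i → a.1 j = b.1 j → a = b)
    {i j : Fin d} (hij : i ≠ j) {p : Φ.Symb → ℝ} (hp : IsProbVec p)
    (hχ : Φ.chi i p ≤ Φ.chi j p) {ε : ℝ} (hε : 0 < ε) :
    ∀ᵐ ω ∂(bernoulli p), ENNReal.ofReal (entCond i p / (Φ.chi j p + ε)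
      + entMarg i p / (Φ.chi i p + ε)) ≤
      lowerPtDim ((bernoulli p).map Φ.coding) (Φ.coding ω) := by
  have := isProbabilityMeasure_bernoulli hp
  have hχi := chi_pos hV i hp
  have hχj := chi_pos hV j hp
  have hsupp : ∀ᵐ ω ∂(bernoulli p), Φ.coding ω ∈ ((bernoulli p).map Φ.coding).support :=
    ae_of_ae_map hV.measurable_coding.aemeasurable Measure.support_mem_ae
  filter_upwards [bernoulli_ae_separation hV hB i hp hε, bernoulli_ae_separation hV hB j hp hε,
    bernoulli_ae_tendsto hp (infoCond i p), bernoulli_ae_tendsto hp (infoMarg i p),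
    bernoulli_ae_pos hp, hsupp] with ω hsi hsj hC hM hpos hω
  have hai : 0 < (Φ.chi i p + ε)⁻¹ := by positivity
  have haj : 0 < (Φ.chi j p + ε)⁻¹ := by positivity
  set ai := (Φ.chi i p + ε)⁻¹ with hai'
  set aj := (Φ.chi j p + ε)⁻¹ with haj'
  have hle : aj ≤ ai := by
    rw [hai', haj']; gcongr
  have hlim := (tendsto_floor_sum_div haj hC).add (tendsto_floor_sum_div hai hM)
  have hlog : Tendsto (fun ρ : ℝ => -Real.log ρ) (𝓝[>] 0) atTop :=
    tendsto_neg_atBot_atTop.comp Real.tendsto_log_nhdsGT_zero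
  have hlim' := ENNReal.tendsto_ofReal (hlim.comp hlog)
  rw [div_eq_mul_inv, div_eq_mul_inv]
  refine (hlim'.liminf_eq.symm.le).trans (liminf_le_liminf ?_)
  have hfi : Tendsto (fun ρ : ℝ => ⌊ai * -Real.log ρ⌋₊) (𝓝[>] 0) atTop :=
    tendsto_nat_floor_atTop.comp (hlog.const_mul_atTop hai)
  have hfj : Tendsto (fun ρ : ℝ => ⌊aj * -Real.log ρ⌋₊) (𝓝[>] 0) atTop :=
    tendsto_nat_floor_atTop.comp (hlog.const_mul_atTop haj)
  filter_upwards [hfi.eventually hsi, hfj.eventually hsj, Ioo_mem_nhdsGT (zero_lt_one' ℝ)]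
    with ρ hi hj hρ
  refine ENNReal.ofReal_le_ofReal ?_
  have hBpos : 0 < -Real.log ρ := neg_pos.2 (Real.log_neg hρ.1 hρ.2)
  have hρexp : ∀ c : ℝ, 0 < c → ρ ≤ Real.exp (-(⌊c⁻¹ * -Real.log ρ⌋₊ * c)) := by
    intro c hc
    rw [← Real.log_le_iff_le_exp hρ.1]
    have := Nat.floor_le (a := c⁻¹ * -Real.log ρ) (by positivity)
    have := mul_le_mul_of_nonneg_right this hc.le
    rw [mul_right_comm, inv_mul_cancel₀ hc.ne', one_mul] at this
    linarith
  have hnm : ⌊aj * -Real.log ρ⌋₊ ≤ ⌊ai * -Real.log ρ⌋₊ :=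
    Nat.floor_mono (mul_le_mul_of_nonneg_right hle hBpos.le)
  have hball : (bernoulli p).map Φ.coding (ball (Φ.coding ω) ρ)
      ≤ ENNReal.ofReal (Real.exp (-(∑ k ∈ Finset.range ⌊aj * -Real.log ρ⌋₊, infoCond i p (ω k)
        + ∑ k ∈ Finset.range ⌊ai * -Real.log ρ⌋₊, infoMarg i p (ω k)))) := by
    rw [Measure.map_apply hV.measurable_coding measurableSet_ball,
      ← bernoulli_cylinder hd hij hp hpos hnm]
    refine measure_mono_ae ?_
    filter_upwards [bernoulli_ae_pos hp] with ω' hω' hmem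
    have hdist : ∀ l, |Φ.coding ω l - Φ.coding ω' l| < ρ := by
      intro l
      rw [← Real.dist_eq]
      exact (dist_le_pi_dist _ _ l).trans_lt (by rw [dist_comm]; exact hmem)
    exact ⟨hj ω' hω' ((hdist j).trans_le (hρexp _ (by positivity))),
      hi ω' hω' ((hdist i).trans_le (hρexp _ (by positivity)))⟩
  have hne : (bernoulli p).map Φ.coding (ball (Φ.coding ω) ρ) ≠ 0 :=
    ((Measure.mem_support_iff_forall _).1 hω _ (ball_mem_nhds _ hρ.1)).ne'
  have hpr := Measure.isProbabilityMeasure_map (μ := bernoulli p) hV.measurable_coding.aemeasurable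
  have hpos' := ENNReal.toReal_pos hne (measure_ne_top _ _)
  have h1 := ENNReal.toReal_le_of_le_ofReal (Real.exp_pos _).le hball
  have h2 := (Real.log_le_iff_le_exp hpos').2 h1
  simp only [Function.comp]
  rw [← neg_div_neg_eq (Real.log _) (Real.log ρ), ← add_div]
  exact div_le_div_of_nonneg_right (by linarith) hBpos.le

theorem exists_bernoulliDims_ge (hV : Φ.Valid) (hB : Φ.Baranski)
    (hd : ∀ a b : Φ.Symb, ∀ i j : Fin d, i ≠ j → a.1 i = b.1 i → a.1 j = b.1 j → a = b)
    {i j : Fin d} (hij : i ≠ j) {p : Φ.Symb → ℝ} (hp : IsProbVec p)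
    (hχ : Φ.chi i p ≤ Φ.chi j p) :
    ENNReal.ofReal (entCond i p / Φ.chi j p + entMarg i p / Φ.chi i p)
      ≤ sSup (bernoulliDims Φ) := by
  have := isProbabilityMeasure_bernoulli hp
  have hχi := chi_pos hV i hp
  have hχj := chi_pos hV j hp
  refine le_trans ?_ (le_sSup ⟨p, hp, bernoulli p, isProductMeasure_bernoulli hp, rfl⟩)
  have hlim : Tendsto (fun ε : ℝ => ENNReal.ofReal (entCond i p / (Φ.chi j p + ε)
      + entMarg i p / (Φ.chi i p + ε))) (𝓝[>] 0)
      (𝓝 (ENNReal.ofReal (entCond i p / Φ.chi j p + entMarg i p / Φ.chi i p))) := by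
    refine ENNReal.tendsto_ofReal (Tendsto.mono_left ?_ nhdsWithin_le_nhds)
    have : ContinuousAt (fun ε : ℝ => entCond i p / (Φ.chi j p + ε)
        + entMarg i p / (Φ.chi i p + ε)) 0 := by
      refine ContinuousAt.add ?_ ?_ <;>
      exact ContinuousAt.div₀ (by fun_prop) (by fun_prop) (by rw [add_zero]; positivity)
    simpa only [ContinuousAt, add_zero] using this
  refine le_of_tendsto hlim ?_
  filter_upwards [self_mem_nhdsWithin] with ε hε
  exact le_measDim_map hV.measurable_coding (bernoulli_ae_le_lowerPtDim hV hB hd hij hp hχ hε)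

theorem sSup_bernoulliDims_le (hV : Φ.Valid) : sSup (bernoulliDims Φ) ≤ dimH Φ.limitSet := by
  refine sSup_le ?_
  rintro _ ⟨p, hp, μ, hμ, rfl⟩
  have := hμ.1
  have := Measure.isProbabilityMeasure_map (μ := μ) hV.measurable_coding.aemeasurable
  exact measDim_le_dimH _ _ (ae_map_mem_range _ hV.measurableSet_limitSet _)

end LowerBound

section Selection

theorem exists_scale_of_eventually_le {S T φ : ℕ → ℝ} {c C s ε : ℝ} (hc : 0 < c)
    (hS : ∀ n, c ≤ S (n + 1) - S n ∧ S (n + 1) - S n ≤ C) (hε : 0 < ε)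
    (h : ∀ᶠ n in atTop, S n ≤ T n ∧ φ n ≤ s) (N : ℕ) :
    ∃ n ≥ N, ∃ m ≥ n, S n ≤ T n ∧ |S m - T n| ≤ C ∧ φ m ≤ φ n + ε := by
  have hmono : StrictMono S := strictMono_nat_of_lt_succ fun n => by linarith [(hS n).1]
  obtain ⟨N₀, hN₀⟩ := eventually_atTop.1 h
  set I := Ici (max N (max N₀ 1)) with hI
  have hbdd : BddAbove (φ '' I) := by
    refine ⟨s, ?_⟩
    rintro _ ⟨n, hn, rfl⟩
    exact (hN₀ n (((le_max_left _ _).trans (le_max_right _ _)).trans hn)).2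
  have hne : (φ '' I).Nonempty := ⟨_, _, mem_Ici.2 le_rfl, rfl⟩
  obtain ⟨_, ⟨n, hn, rfl⟩, hlt⟩ := exists_lt_of_lt_csSup hne
    (show sSup (φ '' I) - ε < sSup (φ '' I) by linarith)
  have hnN : N ≤ n := (le_max_left _ _).trans hn
  have hn0 : N₀ ≤ n := ((le_max_left _ _).trans (le_max_right _ _)).trans hn
  have hn1 : 1 ≤ n := ((le_max_right _ _).trans (le_max_right _ _)).trans hn
  have hle := (hN₀ n hn0).1
  have hlin : ∀ k : ℕ, S 0 + k * c ≤ S k := by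
    intro k
    induction k with
    | zero => simp
    | succ k ih => push_cast; linarith [(hS k).1]
  have hex : ∃ m, T n ≤ S m := by
    obtain ⟨k, hk⟩ := exists_nat_gt ((T n - S 0) / c)
    rw [div_lt_iff₀ hc] at hk
    exact ⟨k, by linarith [hlin k]⟩
  have hm := Nat.find_spec hex
  have hmin : ∀ k < Nat.find hex, S k < T n := fun k hk => not_le.1 (Nat.find_min hex hk)
  set m := Nat.find hex
  have hnm : n ≤ m := hmono.le_iff_le.1 (hle.trans hm)
  refine ⟨n, hnN, m, hnm, hle, ?_, ?_⟩
  · have h1 := hmin (m - 1) (by omega)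
    have h2 := (hS (m - 1)).2
    rw [Nat.sub_add_cancel (by omega)] at h2
    rw [abs_of_nonneg (by linarith)]
    linarith
  · have := le_csSup hbdd ⟨m, hn.trans hnm, rfl⟩
    linarith

theorem exists_scale_of_frequently {S T : ℕ → ℝ} {c C : ℝ} (hc : 0 < c)
    (hS : ∀ n, c ≤ S (n + 1) - S n ∧ S (n + 1) - S n ≤ C)
    (hT : ∀ n, c ≤ T (n + 1) - T n ∧ T (n + 1) - T n ≤ C)
    (h₁ : ∃ᶠ n in atTop, S n ≤ T n) (h₂ : ∃ᶠ n in atTop, T n < S n) (N : ℕ) :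
    ∃ n ≥ N, S n ≤ T n ∧ |S n - T n| ≤ C := by
  obtain ⟨n₁, hn₁, hle⟩ := frequently_atTop.1 h₁ N
  have hex : ∃ k, n₁ ≤ k ∧ T k < S k := by
    obtain ⟨k, hk, hlt⟩ := frequently_atTop.1 h₂ n₁
    exact ⟨k, hk, hlt⟩
  obtain ⟨hk, hlt⟩ := Nat.find_spec hex
  have hmin : ∀ k < Nat.find hex, ¬ (n₁ ≤ k ∧ T k < S k) := fun k => Nat.find_min hex
  set k := Nat.find hex
  have hne : k ≠ n₁ := by rintro h; rw [h] at hlt; linarith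
  have h1 := hmin (k - 1) (by omega)
  have h2 : S (k - 1) ≤ T (k - 1) := not_lt.1 fun h => h1 ⟨by omega, h⟩
  have h3 := hS (k - 1)
  have h4 := hT (k - 1)
  rw [Nat.sub_add_cancel (by omega)] at h3 h4
  refine ⟨k - 1, by omega, h2, ?_⟩
  rw [abs_of_nonpos (by linarith)]
  linarith [h3.2, h4.1]

theorem exists_scale {S T φ ψ : ℕ → ℝ} {c C s ε : ℝ} (hc : 0 < c)
    (hS : ∀ n, c ≤ S (n + 1) - S n ∧ S (n + 1) - S n ≤ C)
    (hT : ∀ n, c ≤ T (n + 1) - T n ∧ T (n + 1) - T n ≤ C) (hε : 0 < ε)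
    (hφ : ∀ n ≥ 1, S n ≤ T n → φ n ≤ s) (hψ : ∀ n ≥ 1, T n ≤ S n → ψ n ≤ s) :
    (∀ N : ℕ, ∃ n ≥ N, ∃ m ≥ n, S n ≤ T n ∧ |S m - T n| ≤ C ∧ φ m ≤ φ n + ε) ∨
    (∀ N : ℕ, ∃ n ≥ N, ∃ m ≥ n, T n ≤ S n ∧ |T m - S n| ≤ C ∧ ψ m ≤ ψ n + ε) := by
  by_cases h₁ : ∀ᶠ n in atTop, S n ≤ T n
  · refine Or.inl (exists_scale_of_eventually_le hc hS hε (s := s) ?_)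
    filter_upwards [h₁, eventually_ge_atTop 1] with n h hn
    exact ⟨h, hφ n hn h⟩
  by_cases h₂ : ∀ᶠ n in atTop, T n ≤ S n
  · refine Or.inr (exists_scale_of_eventually_le hc hT hε (s := s) ?_)
    filter_upwards [h₂, eventually_ge_atTop 1] with n h hn
    exact ⟨h, hψ n hn h⟩
  simp only [not_eventually, not_le] at h₁ h₂
  refine Or.inl fun N => ?_
  obtain ⟨n, hn, hle, habs⟩ :=
    exists_scale_of_frequently hc hS hT (h₂.mono fun _ => le_of_lt) h₁ N
  exact ⟨n, hn, n, le_rfl, hle, habs, by linarith⟩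

end Selection

section Empirical

variable {Φ : DiagIFS d A}

/-- The `n`-th Birkhoff sum of the exponents in coordinate `i`. -/
noncomputable def lyapSum (i : Fin d) (ω : ℕ → Φ.Symb) (n : ℕ) : ℝ :=
  ∑ k ∈ Finset.range n, Φ.lyap i ((ω k).1 i)

/-- The number of occurrences of a letter among the first `n` letters. -/
noncomputable def letterCount (ω : ℕ → Φ.Symb) (n : ℕ) (a : Φ.Symb) : ℕ :=
  ((Finset.range n).filter fun k => ω k = a).card

/-- The frequency vector of a vector of counts. -/
noncomputable def frequency (n : ℕ) (τ : Φ.Symb → ℕ) (a : Φ.Symb) : ℝ := τ a / n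

/-- The empirical distribution of the first `n` letters. -/
noncomputable def empirical (ω : ℕ → Φ.Symb) (n : ℕ) : Φ.Symb → ℝ :=
  frequency n (letterCount ω n)

/-- The total information of the `i`-th digits of the first `n` letters with respect to their
empirical distribution. -/
noncomputable def empMarg (i : Fin d) (ω : ℕ → Φ.Symb) (n : ℕ) : ℝ :=
  ∑ k ∈ Finset.range n, infoMarg i (empirical ω n) (ω k)

/-- The total conditional information of the first `n` letters given their `i`-th digits, with
respect to their empirical distribution. -/
noncomputable def empCond (i : Fin d) (ω : ℕ → Φ.Symb) (n : ℕ) : ℝ :=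
  ∑ k ∈ Finset.range n, infoCond i (empirical ω n) (ω k)

theorem letterCount_le (ω : ℕ → Φ.Symb) (n : ℕ) (a : Φ.Symb) : letterCount ω n a ≤ n :=
  (Finset.card_filter_le _ _).trans (Finset.card_range n).le

theorem sum_empirical_mul (ω : ℕ → Φ.Symb) (n : ℕ) (f : Φ.Symb → ℝ) :
    ∑ a, empirical ω n a * f a = (∑ k ∈ Finset.range n, f (ω k)) / n := by
  have h : ∑ k ∈ Finset.range n, f (ω k) = ∑ a, (letterCount ω n a : ℝ) * f a := by
    rw [← Finset.sum_fiberwise (Finset.range n) ω]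
    refine Finset.sum_congr rfl fun a _ => ?_
    rw [Finset.sum_congr rfl fun k hk => by rw [(Finset.mem_filter.1 hk).2], Finset.sum_const,
      nsmul_eq_mul, letterCount]
  rw [h, Finset.sum_div]
  exact Finset.sum_congr rfl fun a _ => by unfold empirical frequency; ring

theorem isProbVec_empirical (ω : ℕ → Φ.Symb) {n : ℕ} (hn : 1 ≤ n) :
    IsProbVec (empirical ω n) := by
  refine ⟨fun a => by unfold empirical frequency; positivity, ?_⟩
  have h := sum_empirical_mul ω n fun _ => 1
  have hn' : (n : ℝ) ≠ 0 := by positivity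
  simp only [mul_one, Finset.sum_const, Finset.card_range, nsmul_eq_mul, div_self hn'] at h
  exact h

theorem empirical_pos (ω : ℕ → Φ.Symb) {n k : ℕ} (hk : k < n) : 0 < empirical ω n (ω k) := by
  have : 0 < letterCount ω n (ω k) :=
    Finset.card_pos.2 ⟨k, Finset.mem_filter.2 ⟨Finset.mem_range.2 hk, rfl⟩⟩
  have hn : 0 < n := by omega
  unfold empirical frequency; positivity

theorem chi_empirical (i : Fin d) (ω : ℕ → Φ.Symb) (n : ℕ) :
    Φ.chi i (empirical ω n) = lyapSum i ω n / n := by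
  rw [chi_eq_sum, sum_empirical_mul ω n fun a => Φ.lyap i (a.1 i)]; rfl

theorem entMarg_empirical (i : Fin d) (ω : ℕ → Φ.Symb) (n : ℕ) :
    entMarg i (empirical ω n) = empMarg i ω n / n := sum_empirical_mul ω n _

theorem entCond_empirical (i : Fin d) (ω : ℕ → Φ.Symb) (n : ℕ) :
    entCond i (empirical ω n) = empCond i ω n / n := sum_empirical_mul ω n _

theorem infoCond_nonneg (i : Fin d) {p : Φ.Symb → ℝ} (hp : ∀ a, 0 ≤ p a) (a : Φ.Symb) :
    0 ≤ infoCond i p a := by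
  have h := marginal_nonneg i hp (a.1 i)
  exact neg_nonneg.2 (Real.log_nonpos (div_nonneg (hp a) h)
    (div_le_one_of_le₀ (le_marginal i hp a) h))

theorem infoMarg_nonneg (i : Fin d) {p : Φ.Symb → ℝ} (hp : IsProbVec p) (a : Φ.Symb) :
    0 ≤ infoMarg i p a := by
  refine neg_nonneg.2 (Real.log_nonpos (marginal_nonneg i hp.1 _) ?_)
  rw [← hp.2, ← sum_marginal i p]
  exact Finset.single_le_sum (fun x _ => marginal_nonneg i hp.1 x) (Finset.mem_univ (a.1 i))

theorem empCond_nonneg (i : Fin d) (ω : ℕ → Φ.Symb) {n : ℕ} (hn : 1 ≤ n) : 0 ≤ empCond i ω n :=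
  Finset.sum_nonneg fun _ _ => infoCond_nonneg i (isProbVec_empirical ω hn).1 _

theorem empMarg_nonneg (i : Fin d) (ω : ℕ → Φ.Symb) {n : ℕ} (hn : 1 ≤ n) : 0 ≤ empMarg i ω n :=
  Finset.sum_nonneg fun _ _ => infoMarg_nonneg i (isProbVec_empirical ω hn) _

theorem lyapSum_succ_sub (i : Fin d) (ω : ℕ → Φ.Symb) (n : ℕ) :
    lyapSum i ω (n + 1) - lyapSum i ω n = Φ.lyap i ((ω n).1 i) := by
  unfold lyapSum; rw [Finset.sum_range_succ]; ring

theorem mul_le_lyapSum {c : ℝ} {i : Fin d} (hc : ∀ a, c ≤ Φ.lyap i a) (ω : ℕ → Φ.Symb) (n : ℕ) :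
    c * n ≤ lyapSum i ω n := by
  unfold lyapSum
  calc c * n = ∑ k ∈ Finset.range n, c := by simp [mul_comm]
    _ ≤ _ := Finset.sum_le_sum fun k _ => hc _

/-- The pairs of scales `n ≤ m` at which the first `n` letters and the first `m` digits in
coordinate `i` give an approximate square carrying little empirical information. -/
def GoodScale (i j : Fin d) (C t K : ℝ) (ω : ℕ → Φ.Symb) (n m : ℕ) : Prop :=
  lyapSum j ω n - C ≤ lyapSum i ω m ∧ lyapSum i ω m ≤ lyapSum j ω n + C ∧
    empMarg i ω m + empCond i ω n ≤ t * lyapSum j ω n + K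

theorem exists_goodScale {c C s ε : ℝ} (hc : 0 < c)
    (hlyap : ∀ i a, c ≤ Φ.lyap i a ∧ Φ.lyap i a ≤ C) (hε : 0 < ε)
    (hs : ∀ i j : Fin d, i ≠ j → ∀ p : Φ.Symb → ℝ, IsProbVec p → Φ.chi i p ≤ Φ.chi j p →
      entCond i p / Φ.chi j p + entMarg i p / Φ.chi i p ≤ s)
    {i j : Fin d} (hij : i ≠ j) (ω : ℕ → Φ.Symb) :
    (∀ N, ∃ n ≥ N, ∃ m ≥ n, GoodScale i j C (s + ε) (C * (s + ε)) ω n m) ∨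
    (∀ N, ∃ n ≥ N, ∃ m ≥ n, GoodScale j i C (s + ε) (C * (s + ε)) ω n m) := by
  have hpos : ∀ i, ∀ n ≥ 1, 0 < lyapSum i ω n := fun i n hn =>
    lt_of_lt_of_le (by positivity) (mul_le_lyapSum (fun a => (hlyap i a).1) ω n)
  have hbound : ∀ i j : Fin d, i ≠ j → ∀ n ≥ 1, lyapSum i ω n ≤ lyapSum j ω n →
      empCond i ω n / lyapSum j ω n + empMarg i ω n / lyapSum i ω n ≤ s := by
    intro i j hij n hn hle
    have hn' : (n : ℝ) ≠ 0 := by positivity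
    have h := hs i j hij _ (isProbVec_empirical ω hn) (by
      rw [chi_empirical, chi_empirical]; gcongr)
    rwa [chi_empirical, chi_empirical, entMarg_empirical, entCond_empirical,
      div_div_div_cancel_right₀ hn', div_div_div_cancel_right₀ hn'] at h
  have hφ : ∀ i j : Fin d, i ≠ j → ∀ n ≥ 1, lyapSum i ω n ≤ lyapSum j ω n →
      empMarg i ω n / lyapSum i ω n ≤ s := by
    intro i j hij n hn hle
    have := div_nonneg (empCond_nonneg i ω hn) (hpos j n hn).le
    linarith [hbound i j hij n hn hle]
  have hgood : ∀ i j : Fin d, i ≠ j →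
      (∀ N : ℕ, ∃ n ≥ N, ∃ m ≥ n, lyapSum i ω n ≤ lyapSum j ω n ∧
        |lyapSum i ω m - lyapSum j ω n| ≤ C ∧
        empMarg i ω m / lyapSum i ω m ≤ empMarg i ω n / lyapSum i ω n + ε) →
      ∀ N, ∃ n ≥ N, ∃ m ≥ n, GoodScale i j C (s + ε) (C * (s + ε)) ω n m := by
    intro i j hij h N
    obtain ⟨n, hn, m, hnm, hle, habs, hent⟩ := h (max N 1)
    have hn1 : 1 ≤ n := (le_max_right _ _).trans hn
    obtain ⟨h1, h2⟩ := abs_le.1 habs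
    refine ⟨n, (le_max_left _ _).trans hn, m, hnm, by linarith, by linarith, ?_⟩
    have p1 := hpos i m (hn1.trans hnm)
    have p2 := hpos j n hn1
    have b1 := hbound i j hij n hn1 hle
    have b2 := hφ i j hij n hn1 hle
    have b3 := div_nonneg (empMarg_nonneg i ω hn1) (hpos i n hn1).le
    rw [div_le_iff₀ p1] at hent
    set x := empMarg i ω n / lyapSum i ω n
    have hg : empCond i ω n ≤ (s - x) * lyapSum j ω n := (div_le_iff₀ p2).1 (by linarith)
    have hC : 0 ≤ C := (abs_nonneg _).trans habs
    have e1 : (x + ε) * lyapSum i ω m ≤ (x + ε) * (lyapSum j ω n + C) :=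
      mul_le_mul_of_nonneg_left (by linarith) (by linarith)
    have e2 : C * (x + ε) ≤ C * (s + ε) := mul_le_mul_of_nonneg_left (by linarith) hC
    nlinarith
  refine (exists_scale (S := lyapSum i ω) (T := lyapSum j ω)
    (φ := fun n => empMarg i ω n / lyapSum i ω n) (ψ := fun n => empMarg j ω n / lyapSum j ω n)
    hc (C := C) ?_ ?_ hε (hφ i j hij) (hφ j i hij.symm)).imp (hgood i j hij) (hgood j i hij.symm)
  all_goals
    intro n
    rw [lyapSum_succ_sub]
    exact hlyap _ _

end Empirical

section Covering

variable {Φ : DiagIFS d A}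

/-- The conditional weight of a letter `a`: its `i`-th digit is drawn according to `q`, and then
`a` is drawn according to `r` conditioned on its `i`-th digit. -/
noncomputable def letterWeight (i : Fin d) (q r : Φ.Symb → ℝ) (a : Φ.Symb) : ℝ :=
  marginal i q (a.1 i) * (r a / marginal i r (a.1 i))

theorem letterWeight_nonneg (i : Fin d) {q r : Φ.Symb → ℝ} (hq : ∀ a, 0 ≤ q a)
    (hr : ∀ a, 0 ≤ r a) (a : Φ.Symb) : 0 ≤ letterWeight i q r a :=
  mul_nonneg (marginal_nonneg i hq _) (div_nonneg (hr a) (marginal_nonneg i hr _))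

theorem sum_letterWeight_le (i : Fin d) {q r : Φ.Symb → ℝ} (hq : ∀ a, 0 ≤ q a) :
    ∑ a, letterWeight i q r a ≤ ∑ a, q a := by
  rw [← sum_marginal i q, ← Finset.sum_fiberwise Finset.univ fun a : Φ.Symb => a.1 i]
  refine Finset.sum_le_sum fun x _ => ?_
  have h : ∑ a : Φ.Symb with a.1 i = x, letterWeight i q r a
      = marginal i q x * (marginal i r x / marginal i r x) := by
    rw [marginal, marginal, ← Finset.sum_filter, ← Finset.sum_filter, Finset.sum_div,
      Finset.mul_sum]
    refine Finset.sum_congr rfl fun a ha => ?_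
    have ha' := (Finset.mem_filter.1 ha).2
    rw [letterWeight, marginal, marginal, ← Finset.sum_filter, ← Finset.sum_filter, ha']
  rw [h]
  exact mul_le_of_le_one_right (marginal_nonneg i hq x) (div_self_le_one _)

/-- The weight of the box given by `n` letters `w` and `l` further digits `u`. -/
noncomputable def boxWeight (i : Fin d) {n l : ℕ} (q r : Φ.Symb → ℝ) (w : Fin n → Φ.Symb)
    (u : Fin l → A i) : ℝ :=
  (∏ k, letterWeight i q r (w k)) * ∏ k, marginal i q (u k)

theorem boxWeight_nonneg (i : Fin d) {n l : ℕ} {q r : Φ.Symb → ℝ} (hq : ∀ a, 0 ≤ q a)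
    (hr : ∀ a, 0 ≤ r a) (w : Fin n → Φ.Symb) (u : Fin l → A i) : 0 ≤ boxWeight i q r w u :=
  mul_nonneg (Finset.prod_nonneg fun _ _ => letterWeight_nonneg i hq hr _)
    (Finset.prod_nonneg fun _ _ => marginal_nonneg i hq _)

theorem sum_boxWeight_le (i : Fin d) (n l : ℕ) {q r : Φ.Symb → ℝ} (hq : ∀ a, 0 ≤ q a)
    (hr : ∀ a, 0 ≤ r a) (hq1 : ∑ a, q a ≤ 1) :
    ∑ x : (Fin n → Φ.Symb) × (Fin l → A i), boxWeight i q r x.1 x.2 ≤ 1 := by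
  unfold boxWeight
  rw [Fintype.sum_prod_type]
  simp only [← Finset.mul_sum, ← Finset.sum_mul]
  rw [← Fintype.sum_pow, ← Fintype.sum_pow, sum_marginal]
  have h0 : 0 ≤ ∑ a, q a := Finset.sum_nonneg fun a _ => hq a
  have h1 : 0 ≤ ∑ a, letterWeight i q r a :=
    Finset.sum_nonneg fun a _ => letterWeight_nonneg i hq hr a
  exact mul_le_one₀ (pow_le_one₀ h1 ((sum_letterWeight_le i hq).trans hq1)) (pow_nonneg h0 _)
    (pow_le_one₀ h0 hq1)

theorem boxWeight_eq_exp (i : Fin d) (ω : ℕ → Φ.Symb) (n l : ℕ) :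
    boxWeight i (empirical ω (n + l)) (empirical ω n) (fun k : Fin n => ω k)
      (fun k : Fin l => (ω (n + k)).1 i)
      = Real.exp (-(empMarg i ω (n + l) + empCond i ω n)) := by
  have hnn : ∀ n a, 0 ≤ empirical ω n a := fun n a => by unfold empirical frequency; positivity
  have hm : ∀ {n k : ℕ}, k < n → 0 < marginal i (empirical ω n) ((ω k).1 i) := fun hk =>
    (empirical_pos ω hk).trans_le (le_marginal i (hnn _) _)
  have e1 : Real.exp (-empMarg i ω (n + l))
      = ∏ k ∈ Finset.range (n + l), marginal i (empirical ω (n + l)) ((ω k).1 i) := by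
    rw [empMarg, ← Finset.sum_neg_distrib, Real.exp_sum]
    refine Finset.prod_congr rfl fun k hk => ?_
    rw [infoMarg, neg_neg, Real.exp_log (hm (Finset.mem_range.1 hk))]
  have e2 : Real.exp (-empCond i ω n) = ∏ k ∈ Finset.range n,
      (empirical ω n (ω k) / marginal i (empirical ω n) ((ω k).1 i)) := by
    rw [empCond, ← Finset.sum_neg_distrib, Real.exp_sum]
    refine Finset.prod_congr rfl fun k hk => ?_
    have hk := Finset.mem_range.1 hk
    rw [infoCond, neg_neg, Real.exp_log (div_pos (empirical_pos ω hk) (hm hk))]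
  rw [neg_add, Real.exp_add, e1, e2, Finset.prod_range_add, mul_right_comm,
    ← Finset.prod_mul_distrib, boxWeight, Finset.prod_range, Finset.prod_range]
  rfl

theorem tsum_polynomial_mul_exp_ne_top (e : ℕ) {α : ℝ} (hα : 0 < α) :
    ∑' n : ℕ, ENNReal.ofReal (((n : ℝ) + 1) ^ e * Real.exp (-α * n)) ≠ ∞ := by
  have h := (summable_nat_add_iff 1).2 (Real.summable_pow_mul_exp_neg_nat_mul e hα)
  have h' : Summable fun n : ℕ => ((n : ℝ) + 1) ^ e * Real.exp (-α * n) := by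
    refine (h.mul_left (Real.exp α)).congr fun n => ?_
    push_cast
    rw [mul_left_comm, ← Real.exp_add]
    ring_nf
  exact h'.tsum_ofReal_ne_top

/-- Index set of the boxes: `n` letters, `l` further digits, and the letter counts at both
scales. -/
abbrev BoxIndex (Φ : DiagIFS d A) (i : Fin d) : Type _ :=
  (n : ℕ) × (l : ℕ) × ((Φ.Symb → Fin (n + 1)) × (Φ.Symb → Fin (n + l + 1))) ×
    ((Fin n → Φ.Symb) × (Fin l → A i))

instance (i : Fin d) : Countable (BoxIndex Φ i) := by
  unfold BoxIndex
  infer_instance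

/-- The set of codings of good scales with the given index. -/
def boxCodes (i j : Fin d) (C t K : ℝ) (N : ℕ) (b : BoxIndex Φ i) : Set (ℕ → Φ.Symb) :=
  {ω | N ≤ b.1 ∧ GoodScale i j C t K ω b.1 (b.1 + b.2.1) ∧
    (∀ a, letterCount ω b.1 a = b.2.2.1.1 a) ∧
    (∀ a, letterCount ω (b.1 + b.2.1) a = b.2.2.1.2 a) ∧
    (∀ k : Fin b.1, ω k = b.2.2.2.1 k) ∧ ∀ k : Fin b.2.1, (ω (b.1 + k)).1 i = b.2.2.2.2 k}

/-- The weight of the box with the given index, set to zero for impossible counts. -/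
noncomputable def indexWeight {i : Fin d} (b : BoxIndex Φ i) : ℝ :=
  if ∑ a, (b.2.2.1.2 a : ℕ) ≤ b.1 + b.2.1 then
    boxWeight i (frequency (b.1 + b.2.1) fun a => b.2.2.1.2 a)
      (frequency b.1 fun a => b.2.2.1.1 a) b.2.2.2.1 b.2.2.2.2
  else 0

theorem sum_letterCount (ω : ℕ → Φ.Symb) (n : ℕ) : ∑ a, letterCount ω n a = n := by
  have := Finset.card_eq_sum_card_fiberwise (f := ω) (s := Finset.range n) (t := Finset.univ)
    fun _ _ => Finset.mem_coe.2 (Finset.mem_univ _)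
  rw [Finset.card_range] at this
  exact this.symm

theorem exists_mem_boxCodes {i j : Fin d} {C t K : ℝ} {N n m : ℕ} {ω : ℕ → Φ.Symb} (hn : N ≤ n)
    (hnm : n ≤ m) (h : GoodScale i j C t K ω n m) :
    ∃ b : BoxIndex Φ i, ω ∈ boxCodes i j C t K N b := by
  obtain ⟨l, rfl⟩ := Nat.exists_eq_add_of_le hnm
  exact ⟨⟨n, l, (fun a => ⟨letterCount ω n a, Nat.lt_succ_of_le (letterCount_le ω n a)⟩,
    fun a => ⟨letterCount ω (n + l) a, Nat.lt_succ_of_le (letterCount_le ω (n + l) a)⟩),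
    (fun k => ω k, fun k => (ω (n + k)).1 i)⟩, hn, h, fun _ => rfl, fun _ => rfl, fun _ => rfl,
    fun _ => rfl⟩

theorem indexWeight_eq_exp {i j : Fin d} {C t K : ℝ} {N : ℕ} {b : BoxIndex Φ i}
    {ω : ℕ → Φ.Symb} (hω : ω ∈ boxCodes i j C t K N b) :
    indexWeight b = Real.exp (-(empMarg i ω (b.1 + b.2.1) + empCond i ω b.1)) := by
  obtain ⟨-, -, h1, h2, h3, h4⟩ := hω
  have hle : ∑ a, (b.2.2.1.2 a : ℕ) ≤ b.1 + b.2.1 := by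
    rw [← Finset.sum_congr rfl fun a _ => h2 a, sum_letterCount]
  rw [← boxWeight_eq_exp, indexWeight, if_pos hle]
  unfold empirical
  rw [funext h1, funext h2, funext h3, funext h4]

theorem ediam_boxCodes_le (hV : Φ.Valid) {i j : Fin d} (hall : ∀ l, l = i ∨ l = j)
    {C t K : ℝ} (hC : 0 ≤ C) {N : ℕ} {b : BoxIndex Φ i} {ω : ℕ → Φ.Symb}
    (hω : ω ∈ boxCodes i j C t K N b) :
    ediam (Φ.coding '' boxCodes i j C t K N b)
      ≤ ENNReal.ofReal (Real.exp (C - lyapSum j ω b.1)) := by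
  refine ediam_le ?_
  rintro _ ⟨ω₁, h₁, rfl⟩ _ ⟨ω₂, h₂, rfl⟩
  rw [edist_dist]
  refine ENNReal.ofReal_le_ofReal ((dist_pi_le_iff (Real.exp_pos _).le).2 fun l => ?_)
  obtain ⟨-, hω1, -, -, hω3, -⟩ := hω
  obtain ⟨-, h11, -, -, h13, h14⟩ := h₁
  obtain ⟨-, -, -, -, h23, h24⟩ := h₂
  have hlet : ∀ k < b.1, ω₁ k = ω₂ k := fun k hk =>
    (h13 ⟨k, hk⟩).trans (h23 ⟨k, hk⟩).symm
  have hlet' : ∀ k < b.1, ω₁ k = ω k := fun k hk =>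
    (h13 ⟨k, hk⟩).trans (hω3 ⟨k, hk⟩).symm
  have hS : lyapSum j ω₁ b.1 = lyapSum j ω b.1 :=
    Finset.sum_congr rfl fun k hk => by rw [hlet' k (Finset.mem_range.1 hk)]
  rw [Real.dist_eq]
  rcases hall l with rfl | rfl
  · refine (hV.abs_code_sub_le l (b.1 + b.2.1) _ _ fun k hk => ?_).trans
      (Real.exp_le_exp.2 ?_)
    · rcases lt_or_ge k b.1 with h | h
      · rw [hlet k h]
      · obtain ⟨r, rfl⟩ := Nat.exists_eq_add_of_le h
        have hr : r < b.2.1 := by omega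
        exact (h14 ⟨r, hr⟩).trans (h24 ⟨r, hr⟩).symm
    · have := h11.1
      rw [hS] at this
      change -lyapSum l ω₁ (b.1 + b.2.1) ≤ _
      linarith
  · refine (hV.abs_code_sub_le l b.1 _ _ fun k hk => by rw [hlet k hk]).trans
      (Real.exp_le_exp.2 ?_)
    change -lyapSum l ω₁ b.1 ≤ _
    rw [hS]; linarith

theorem ediam_rpow_boxCodes_le (hV : Φ.Valid) {i j : Fin d} (hall : ∀ l, l = i ∨ l = j)
    {c C t δ K : ℝ} (hC : 0 ≤ C) (hc : ∀ i a, c ≤ Φ.lyap i a) (ht : 0 ≤ t) (hδ : 0 < δ) (N : ℕ)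
    (b : BoxIndex Φ i) :
    ediam (Φ.coding '' boxCodes i j C t K N b) ^ (t + δ)
      ≤ ENNReal.ofReal (Real.exp (C * (t + δ) + K + δ * C) *
        (Real.exp (-(c * δ / 2) * b.1) * Real.exp (-(c * δ / 2) * (b.1 + b.2.1 : ℕ)) *
          indexWeight b)) := by
  rcases (boxCodes i j C t K N b).eq_empty_or_nonempty with he | ⟨ω, hω⟩
  · rw [he, image_empty, ediam_empty, ENNReal.zero_rpow_of_pos (by positivity)]
    exact zero_le
  refine (ENNReal.rpow_le_rpow (ediam_boxCodes_le hV hall hC hω) (by positivity)).trans ?_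
  rw [ENNReal.ofReal_rpow_of_pos (Real.exp_pos _), indexWeight_eq_exp hω]
  refine ENNReal.ofReal_le_ofReal ?_
  rw [← Real.exp_mul, ← Real.exp_add, ← Real.exp_add, ← Real.exp_add]
  refine Real.exp_le_exp.2 ?_
  obtain ⟨-, ⟨-, h2, h3⟩, -⟩ := hω
  have h4 := mul_le_lyapSum (hc i) ω (b.1 + b.2.1)
  have h5 := mul_le_lyapSum (hc j) ω b.1
  have h6 := mul_le_mul_of_nonneg_left h5 hδ.le
  have h7 := mul_le_mul_of_nonneg_left (h4.trans h2) hδ.le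
  nlinarith

theorem sum_indexWeight_le (i : Fin d) (n l : ℕ)
    (τ : (Φ.Symb → Fin (n + 1)) × (Φ.Symb → Fin (n + l + 1))) :
    ∑ x : (Fin n → Φ.Symb) × (Fin l → A i), indexWeight (⟨n, l, τ, x⟩ : BoxIndex Φ i) ≤ 1 := by
  have hnn : ∀ n (τ : Φ.Symb → ℕ) a, 0 ≤ frequency n τ a := fun n τ a => by
    unfold frequency; positivity
  unfold indexWeight
  dsimp only
  split_ifs with h
  · refine sum_boxWeight_le i n l (hnn _ _) (hnn _ _) ?_
    unfold frequency
    rw [← Finset.sum_div]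
    refine div_le_one_of_le₀ ?_ (Nat.cast_nonneg _)
    exact_mod_cast h
  · rw [Finset.sum_const_zero]; exact zero_le_one

theorem indexWeight_nonneg {i : Fin d} (b : BoxIndex Φ i) : 0 ≤ indexWeight b := by
  have hnn : ∀ n (τ : Φ.Symb → ℕ) a, 0 ≤ frequency n τ a := fun n τ a => by
    unfold frequency; positivity
  unfold indexWeight
  split_ifs
  exacts [boxWeight_nonneg i (hnn _ _) (hnn _ _) _ _, le_rfl]

theorem tsum_indexWeight_ne_top (i : Fin d) {α M : ℝ} (hα : 0 < α) (hM : 0 ≤ M) :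
    ∑' b : BoxIndex Φ i, ENNReal.ofReal (M * (Real.exp (-α * b.1) *
      Real.exp (-α * (b.1 + b.2.1 : ℕ)) * indexWeight b)) ≠ ∞ := by
  set e := Fintype.card Φ.Symb with he
  set f : ℕ → ℝ≥0∞ := fun n => ENNReal.ofReal (((n : ℝ) + 1) ^ e * Real.exp (-α * n)) with hf
  have hfsum : ∑' n, f n ≠ ∞ := tsum_polynomial_mul_exp_ne_top e hα
  have hfin : ∀ n l : ℕ, ∑' x : ((Φ.Symb → Fin (n + 1)) × (Φ.Symb → Fin (n + l + 1))) ×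
      ((Fin n → Φ.Symb) × (Fin l → A i)), ENNReal.ofReal (M * (Real.exp (-α * n) *
        Real.exp (-α * (n + l : ℕ)) * indexWeight (⟨n, l, x⟩ : BoxIndex Φ i)))
      ≤ ENNReal.ofReal M * (f n * f (n + l)) := by
    intro n l
    have hD : 0 ≤ M * Real.exp (-α * n) * Real.exp (-α * (n + l : ℕ)) := by positivity
    rw [tsum_fintype, Fintype.sum_prod_type]
    simp only [← mul_assoc M]
    calc _ ≤ ∑ τ : (Φ.Symb → Fin (n + 1)) × (Φ.Symb → Fin (n + l + 1)),
          ENNReal.ofReal (M * Real.exp (-α * n) * Real.exp (-α * (n + l : ℕ))) := by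
          refine Finset.sum_le_sum fun τ _ => ?_
          rw [← ENNReal.ofReal_sum_of_nonneg fun x _ => mul_nonneg hD (indexWeight_nonneg _),
            ← Finset.mul_sum]
          exact ENNReal.ofReal_le_ofReal
            (mul_le_of_le_one_right hD (sum_indexWeight_le i n l τ))
      _ = ENNReal.ofReal M * (f n * f (n + l)) := by
          rw [Finset.sum_const, Finset.card_univ, Fintype.card_prod, Fintype.card_fun,
            Fintype.card_fun, Fintype.card_fin, Fintype.card_fin, ← ENNReal.ofReal_nsmul, hf,
            ← ENNReal.ofReal_mul (by positivity), ← ENNReal.ofReal_mul hM, nsmul_eq_mul]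
          push_cast
          congr 1
          ring
  refine ne_top_of_le_ne_top (b := ENNReal.ofReal M * ((∑' n, f n) * ∑' n, f n))
    (ENNReal.mul_ne_top ENNReal.ofReal_ne_top (ENNReal.mul_ne_top hfsum hfsum)) ?_
  rw [ENNReal.tsum_sigma']
  simp only [ENNReal.tsum_sigma']
  calc _ ≤ ∑' n, ∑' l, ENNReal.ofReal M * (f n * f (n + l)) :=
        ENNReal.tsum_le_tsum fun n => ENNReal.tsum_le_tsum fun l => hfin n l
    _ = ENNReal.ofReal M * ∑' n, f n * ∑' l, f (n + l) := by
        simp only [ENNReal.tsum_mul_left]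
    _ ≤ ENNReal.ofReal M * ∑' n, f n * ∑' m, f m :=
        mul_le_mul_right (ENNReal.tsum_le_tsum fun n => mul_le_mul_right
          (ENNReal.tsum_comp_le_tsum_of_injective (add_right_injective n) f) _) _
    _ = _ := by rw [ENNReal.tsum_mul_right]

theorem dimH_goodScale_le (hV : Φ.Valid) {i j : Fin d} (hall : ∀ l, l = i ∨ l = j)
    {C t δ K : ℝ} (hC : 0 ≤ C) (ht : 0 ≤ t) (hδ : 0 < δ) :
    dimH (Φ.coding '' {ω | ∀ N, ∃ n ≥ N, ∃ m ≥ n, GoodScale i j C t K ω n m})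
      ≤ ENNReal.ofReal (t + δ) := by
  obtain ⟨c, _, hc, -, hlyap⟩ := hV.exists_lyap_bounds
  have hc' : ∀ i a, c ≤ Φ.lyap i a := fun i a => (hlyap i a).1
  refine dimH_le_of_hausdorffMeasure_ne_top ?_
  rw [Real.coe_toNNReal _ (by positivity)]
  refine ne_top_of_le_ne_top (tsum_indexWeight_ne_top (Φ := Φ) i (α := c * δ / 2)
    (M := Real.exp (C * (t + δ) + K + δ * C)) (by positivity) (Real.exp_pos _).le) ?_
  refine (Measure.hausdorffMeasure_le_liminf_tsum (ι := fun _ : ℕ => BoxIndex Φ i) (t + δ) _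
    (l := atTop) (fun N : ℕ => ENNReal.ofReal (Real.exp (C - c * N))) ?_
    (fun N b => Φ.coding '' boxCodes i j C t K N b) ?_ ?_).trans ?_
  · rw [← ENNReal.ofReal_zero]
    refine ENNReal.tendsto_ofReal (Real.tendsto_exp_atBot.comp ?_)
    exact tendsto_atBot_add_const_left _ _
      (tendsto_neg_atTop_atBot.comp (tendsto_natCast_atTop_atTop.const_mul_atTop hc))
  · refine Eventually.of_forall fun N b => ?_
    rcases (boxCodes i j C t K N b).eq_empty_or_nonempty with he | ⟨ω, hω⟩
    · rw [he, image_empty, ediam_empty]; exact zero_le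
    · refine (ediam_boxCodes_le hV hall hC hω).trans
        (ENNReal.ofReal_le_ofReal (Real.exp_le_exp.2 ?_))
      have h1 := mul_le_lyapSum (hc' j) ω b.1
      have h2 : (N : ℝ) ≤ b.1 := by exact_mod_cast hω.1
      nlinarith
  · refine Eventually.of_forall fun N => ?_
    rintro _ ⟨ω, hω, rfl⟩
    obtain ⟨n, hn, m, hnm, h⟩ := hω N
    obtain ⟨b, hb⟩ := exists_mem_boxCodes hn hnm h
    exact mem_iUnion.2 ⟨b, ω, hb, rfl⟩
  · refine liminf_le_of_le (h := fun x hx => ?_)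
    obtain ⟨N, hN⟩ := hx.exists
    exact hN.trans (ENNReal.tsum_le_tsum fun b =>
      ediam_rpow_boxCodes_le hV hall hC hc' ht hδ N b)

theorem dimH_limitSet_le (hV : Φ.Valid) {i j : Fin d} (hij : i ≠ j)
    (hall : ∀ l, l = i ∨ l = j) {s : ℝ} (hs0 : 0 ≤ s)
    (hs : ∀ i j : Fin d, i ≠ j → ∀ p : Φ.Symb → ℝ, IsProbVec p → Φ.chi i p ≤ Φ.chi j p →
      entCond i p / Φ.chi j p + entMarg i p / Φ.chi i p ≤ s) :
    dimH Φ.limitSet ≤ ENNReal.ofReal s := by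
  obtain ⟨c, C, hc, hC, hlyap⟩ := hV.exists_lyap_bounds
  have hlim : Tendsto (fun ε : ℝ => ENNReal.ofReal (s + ε + ε)) (𝓝[>] 0)
      (𝓝 (ENNReal.ofReal s)) := by
    refine ENNReal.tendsto_ofReal (Tendsto.mono_left ?_ nhdsWithin_le_nhds)
    have : Continuous fun ε : ℝ => s + ε + ε := by fun_prop
    simpa using this.tendsto 0
  refine ge_of_tendsto hlim ?_
  filter_upwards [self_mem_nhdsWithin] with ε hε
  have hε' : 0 < ε := hε
  have hsub : Φ.limitSet ⊆
      Φ.coding '' {ω | ∀ N, ∃ n ≥ N, ∃ m ≥ n, GoodScale i j C (s + ε) (C * (s + ε)) ω n m} ∪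
      Φ.coding '' {ω | ∀ N, ∃ n ≥ N, ∃ m ≥ n, GoodScale j i C (s + ε) (C * (s + ε)) ω n m} := by
    rintro _ ⟨ω, rfl⟩
    exact (exists_goodScale hc hlyap hε' hs hij ω).imp (fun h => ⟨ω, h, rfl⟩)
      fun h => ⟨ω, h, rfl⟩
  refine (dimH_mono hsub).trans ?_
  rw [dimH_union]
  exact max_le (dimH_goodScale_le hV hall hC.le (by positivity) hε')
    (dimH_goodScale_le hV (fun l => (hall l).symm) hC.le (by positivity) hε')

end Covering

/-- **Barański's theorem.** The Hausdorff dimension of a Barański carpet (a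
two-dimensional Barański sponge) equals the supremum of the Hausdorff dimensions
of its Bernoulli measures. -/
theorem baranski_carpet_dimH {A : Fin 2 → Type} [∀ i, Fintype (A i)]
    (Φ : DiagIFS 2 A) (hV : Φ.Valid) (hB : Φ.Baranski) :
    dimH Φ.limitSet = sSup (bernoulliDims Φ) := by
  have hall : ∀ l : Fin 2, l = 0 ∨ l = 1 := by decide
  have hd : ∀ a b : Φ.Symb, ∀ i j : Fin 2, i ≠ j → a.1 i = b.1 i → a.1 j = b.1 j → a = b := by
    intro a b i j hij hi hj
    refine Subtype.ext (funext fun l => ?_)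
    have hl : l = i ∨ l = j := by omega
    rcases hl with rfl | rfl
    exacts [hi, hj]
  refine le_antisymm ?_ (sSup_bernoulliDims_le hV)
  rcases eq_or_ne (sSup (bernoulliDims Φ)) ∞ with htop | htop
  · rw [htop]; exact le_top
  rw [← ENNReal.ofReal_toReal htop]
  refine dimH_limitSet_le hV (zero_ne_one (α := Fin 2)) hall ENNReal.toReal_nonneg
    fun i j hij p hp hχ => ?_
  have h := exists_bernoulliDims_ge hV hB hd hij hp hχ
  rw [← ENNReal.ofReal_toReal htop] at h
  exact (ENNReal.ofReal_le_ofReal_iff ENNReal.toReal_nonneg).1 h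

end SelfAffineSponge
end

section
/- Let Δ ⊂ ℝ^n be the simplex of probability vectors, u its barycenter, and z : ℝ → Δ a continuous ρ-periodic function with (1/ρ)∫_0^ρ z(t) dt = u. Let Z : ℝ → ℝ^n be the antiderivative of z − u with ∫_0^ρ Z(t) dt = 0 (then Z is ρ-periodic). For γ > 0 define s_b = z(log(b)/γ) for b > 0 and S^{(γ)}_B = ∫_0^B s_b db. Then there exist constants C > 0 and γ_0 > 0 such that for all 0 < γ ≤ γ_0 and all t ∈ ℝ: ‖S^{(γ)}_{e^{γt}} − e^{γt}(u + γZ(t))‖ ≤ C γ² e^{γt}; i.e., S^{(γ)}_{e^{γt}} = e^{γt}[u + γZ(t) + O(γ²)] uniformly in t as γ → 0. -/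
open MeasureTheory Filter Set
open scoped Topology

section

variable {E : Type*} [NormedAddCommGroup E]

/-- An antiderivative of a continuous periodic function of mean zero is periodic. -/
theorem Function.Periodic.of_hasDerivAt [NormedSpace ℝ E] [CompleteSpace E] {f F : ℝ → E} {ρ : ℝ}
    (hf : Continuous f) (hper : Function.Periodic f ρ) (hmean : ∫ t in (0 : ℝ)..ρ, f t = 0)
    (hF : ∀ t, HasDerivAt F (f t) t) : Function.Periodic F ρ := by
  intro t
  have h := intervalIntegral.integral_eq_sub_of_hasDerivAt (a := t) (b := t + ρ)
    (fun x _ => hF x) (hf.intervalIntegrable _ _)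
  rw [hper.intervalIntegral_add_eq t 0, zero_add, hmean] at h
  exact sub_eq_zero.mp h.symm

theorem exists_norm_le_of_periodic {F : ℝ → E} {ρ : ℝ} (hρ : 0 < ρ)
    (hF : Continuous F) (hper : Function.Periodic F ρ) : ∃ M, ∀ t, ‖F t‖ ≤ M := by
  obtain ⟨M, hM⟩ := (hper.isBounded_of_continuous hρ.ne' hF).exists_norm_le
  exact ⟨M, fun t => hM _ (mem_range_self t)⟩

theorem intervalIntegrable_comp_log_div {f : ℝ → E} {M : ℝ} (hf : Continuous f)
    (hM : ∀ t, ‖f t‖ ≤ M) (γ a b : ℝ) :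
    IntervalIntegrable (fun x => f (Real.log x / γ)) volume a b :=
  (intervalIntegrable_const (c := M)).mono_fun'
    (hf.comp_stronglyMeasurable
      (Real.measurable_log.div_const γ).stronglyMeasurable).aestronglyMeasurable
    (Eventually.of_forall fun _ => hM _)

/-- Integration by parts on a logarithmic time scale. -/
theorem integral_comp_log_div [NormedSpace ℝ E] [CompleteSpace E] {f F : ℝ → E} {M N γ B : ℝ} (hf : Continuous f)
    (hF : ∀ t, HasDerivAt F (f t) t) (hM : ∀ t, ‖f t‖ ≤ M) (hN : ∀ t, ‖F t‖ ≤ N)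
    (hγ : 0 < γ) (hB : 0 ≤ B) :
    ∫ b in (0 : ℝ)..B, f (Real.log b / γ) =
      (γ * B) • F (Real.log B / γ) - γ • ∫ b in (0 : ℝ)..B, F (Real.log b / γ) := by
  have hFc : Continuous F := continuous_iff_continuousAt.2 fun t => (hF t).continuousAt
  have hfi := intervalIntegrable_comp_log_div hf hM γ 0 B
  have hFi : IntervalIntegrable (fun b => γ • F (Real.log b / γ)) volume 0 B :=
    (intervalIntegrable_comp_log_div hFc hN γ 0 B).smul γ
  have hderiv : ∀ x ∈ Ioi (0 : ℝ), HasDerivAt (fun b => (γ * b) • F (Real.log b / γ))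
      (f (Real.log x / γ) + γ • F (Real.log x / γ)) x := by
    intro x hx
    have hx0 : x ≠ 0 := ne_of_gt hx
    have h1 := (hF (Real.log x / γ)).scomp x ((Real.hasDerivAt_log hx0).div_const γ)
    have h2 := ((hasDerivAt_id x).const_mul γ).smul h1
    refine h2.congr_deriv ?_
    have h3 : γ * x * (x⁻¹ / γ) = 1 := by field_simp
    simp only [id_eq, Function.comp_apply, smul_smul, mul_one, h3, one_smul]
  have hcont : ContinuousOn (fun b => (γ * b) • F (Real.log b / γ)) (Icc 0 B) := by
    intro x hx
    rcases hx.1.eq_or_lt with rfl | h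
    · refine ContinuousAt.continuousWithinAt ?_
      have h0 : Tendsto (fun b : ℝ => γ * b) (𝓝 0) (𝓝 0) := by
        simpa using (continuous_const_mul γ).tendsto (0 : ℝ)
      have := h0.zero_smul_isBoundedUnder_le (g := fun b => F (Real.log b / γ))
        (isBoundedUnder_of ⟨N, fun b => hN _⟩)
      simpa [ContinuousAt] using this
    · exact (hderiv x h).continuousAt.continuousWithinAt
  have h := intervalIntegral.integral_eq_sub_of_hasDerivAt_of_le hB hcont
    (fun x hx => hderiv x hx.1) (hfi.add hFi)
  rw [intervalIntegral.integral_add hfi hFi] at h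
  simp only [intervalIntegral.integral_smul, mul_zero, zero_smul, sub_zero] at h
  exact eq_sub_of_add_eq h

end

/-- Asymptotics of the cumulative measure of the circular cycle: if `z : ℝ → Δ` is a
continuous `ρ`-periodic curve in the probability simplex with average `u` (the
barycenter), `Z` is the antiderivative of `z - u` with `∫_0^ρ Z = 0`, and for
`γ > 0` we set `s_b = z(log b / γ)` and `S^{(γ)}_B = ∫_0^B s_b db`, then
`S^{(γ)}_{e^{γt}} = e^{γt}[u + γ Z(t) + O(γ²)]` uniformly in `t` as `γ → 0`. -/
theorem cycle_integral_asymptotics {n : ℕ} (hn : 0 < n) (ρ : ℝ) (hρ : 0 < ρ)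
    (z : ℝ → Fin n → ℝ) (hzcont : Continuous z) (hzper : ∀ t, z (t + ρ) = z t)
    (hzsimplex : ∀ t, (∀ j, 0 ≤ z t j) ∧ ∑ j, z t j = 1)
    (hzavg : ρ⁻¹ • (∫ t in Set.Ioc (0:ℝ) ρ, z t) = fun _ : Fin n => (n : ℝ)⁻¹)
    (Z : ℝ → Fin n → ℝ)
    (hZderiv : ∀ t, HasDerivAt Z (z t - fun _ : Fin n => (n : ℝ)⁻¹) t)
    (hZavg : (∫ t in Set.Ioc (0:ℝ) ρ, Z t) = 0) :
    ∃ C > 0, ∃ γ₀ > 0, ∀ γ : ℝ, 0 < γ → γ ≤ γ₀ → ∀ t : ℝ,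
      ‖(∫ b in Set.Ioc (0:ℝ) (Real.exp (γ * t)), z (Real.log b / γ)) -
          Real.exp (γ * t) • ((fun _ : Fin n => (n : ℝ)⁻¹) + γ • Z t)‖ ≤
        C * γ ^ 2 * Real.exp (γ * t) := by
  set u : Fin n → ℝ := fun _ => (n : ℝ)⁻¹ with hu
  have hZc : Continuous Z := continuous_iff_continuousAt.2 fun t => (hZderiv t).continuousAt
  have hfc : Continuous fun t => z t - u := hzcont.sub continuous_const
  have hfper : Function.Periodic (fun t => z t - u) ρ := fun t => by simp only [hzper]
  rw [← intervalIntegral.integral_of_le hρ.le] at hzavg hZavg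
  have hfmean : ∫ t in (0 : ℝ)..ρ, (z t - u) = 0 := by
    rw [intervalIntegral.integral_sub (hzcont.intervalIntegrable _ _) intervalIntegrable_const,
      intervalIntegral.integral_const, sub_zero, ← hzavg, smul_smul, mul_inv_cancel₀ hρ.ne',
      one_smul, sub_self]
  have hZper := Function.Periodic.of_hasDerivAt hfc hfper hfmean hZderiv
  have hWderiv : ∀ t, HasDerivAt (fun x => ∫ s in (0 : ℝ)..x, Z s) (Z t) t := fun t =>
    hZc.integral_hasStrictDerivAt 0 t |>.hasDerivAt
  set W : ℝ → Fin n → ℝ := fun x => ∫ s in (0 : ℝ)..x, Z s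
  have hWc : Continuous W := continuous_iff_continuousAt.2 fun t => (hWderiv t).continuousAt
  have hWper := Function.Periodic.of_hasDerivAt hZc hZper hZavg hWderiv
  obtain ⟨L, hL⟩ := exists_norm_le_of_periodic hρ hfc hfper
  obtain ⟨M, hM⟩ := exists_norm_le_of_periodic hρ hZc hZper
  obtain ⟨N, hN⟩ := exists_norm_le_of_periodic hρ hWc hWper
  have hN0 : 0 ≤ N := (norm_nonneg _).trans (hN 0)
  refine ⟨2 * N + 1, by positivity, 1, one_pos, fun γ hγ _ t => ?_⟩
  have hB : 0 < Real.exp (γ * t) := Real.exp_pos _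
  have hlog : Real.log (Real.exp (γ * t)) / γ = t := by
    rw [Real.log_exp, mul_div_cancel_left₀ _ hγ.ne']
  rw [← intervalIntegral.integral_of_le hB.le]
  set B := Real.exp (γ * t)
  have h1 := integral_comp_log_div hfc hZderiv hL hM hγ hB.le
  have h2 := integral_comp_log_div hZc hWderiv hM hN hγ hB.le
  have hsplit : ∫ b in (0 : ℝ)..B, z (Real.log b / γ) =
      (∫ b in (0 : ℝ)..B, (z (Real.log b / γ) - u)) + B • u := by
    have h := intervalIntegral.integral_add
      (intervalIntegrable_comp_log_div hfc hL γ 0 B) (intervalIntegrable_const (c := u))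
    simpa only [sub_add_cancel, intervalIntegral.integral_const, sub_zero] using h
  have hint : ‖∫ b in (0 : ℝ)..B, W (Real.log b / γ)‖ ≤ N * B := by
    simpa [abs_of_pos hB] using intervalIntegral.norm_integral_le_of_norm_le_const
      (a := 0) (b := B) (f := fun b => W (Real.log b / γ)) fun b _ => hN _
  have herr : (∫ b in (0 : ℝ)..B, z (Real.log b / γ)) - B • (u + γ • Z t) =
      γ ^ 2 • ((∫ b in (0 : ℝ)..B, W (Real.log b / γ)) - B • W t) := by
    rw [hsplit, h1, h2, hlog]
    module
  rw [herr, norm_smul, Real.norm_of_nonneg (by positivity)]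
  have hW : ‖B • W t‖ ≤ N * B := by
    rw [norm_smul, Real.norm_of_nonneg hB.le, mul_comm]
    gcongr
    exact hN t
  calc γ ^ 2 * ‖(∫ b in (0 : ℝ)..B, W (Real.log b / γ)) - B • W t‖
      ≤ γ ^ 2 * (N * B + N * B) := by
        gcongr
        exact (norm_sub_le _ _).trans (add_le_add hint hW)
    _ ≤ (2 * N + 1) * γ ^ 2 * B := by
        have : 0 ≤ γ ^ 2 * B := by positivity
        linarith
end

section
/- Let K̃ be the 3×3 matrix with rows K̃_1 = (1,0,−1), K̃_2 = (−1,1,0), K̃_3 = (0,−1,1), and Ỹ the 3×3 matrix with rows Ỹ_1 = (1,−1,0), Ỹ_2 = (0,1,−1), Ỹ_3 = (−1,0,1), and let Z(t) = (1/3)(sin t, sin(t+2π/3), sin(t+4π/3)) with derivative Z'(t) = (1/3)(cos t, cos(t+2π/3), cos(t+4π/3)). Then: (i) K̃_1 + K̃_2 + K̃_3 = 0; (ii) Σ_{i=1}^3 ⟨K̃_i, q⟩⟨Ỹ_i, q⟩ > 0 for every q ∈ ℝ³ that is not a scalar multiple of (1,1,1); and (iii) Σ_{i=1}^3 ⟨K̃_i,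 Z'(t)⟩⟨Ỹ_i, Z(t)⟩ < 0 for every t ∈ ℝ. -/
open Real

/-- The explicit data used in the construction of a three-dimensional sponge with a
dimension gap: with `K̃`, `Ỹ` the given `3×3` matrices and
`Z(t) = (1/3)(sin t, sin(t+2π/3), sin(t+4π/3))` (with derivative
`Z'(t) = (1/3)(cos t, cos(t+2π/3), cos(t+4π/3))`), we have
(i) `K̃₁ + K̃₂ + K̃₃ = 0`;
(ii) `Σᵢ ⟨K̃ᵢ,q⟩⟨Ỹᵢ,q⟩ > 0` for all `q` not a multiple of `(1,1,1)`;
(iii) `Σᵢ ⟨K̃ᵢ,Z'(t)⟩⟨Ỹᵢ,Z(t)⟩ < 0` for all `t`. -/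
theorem dimension_gap_matrices :
    let K : Fin 3 → Fin 3 → ℝ := ![![1, 0, -1], ![-1, 1, 0], ![0, -1, 1]]
    let Y : Fin 3 → Fin 3 → ℝ := ![![1, -1, 0], ![0, 1, -1], ![-1, 0, 1]]
    let Z : ℝ → Fin 3 → ℝ := fun t =>
      (1/3 : ℝ) • ![Real.sin t, Real.sin (t + 2 * Real.pi / 3),
        Real.sin (t + 4 * Real.pi / 3)]
    let Z' : ℝ → Fin 3 → ℝ := fun t =>
      (1/3 : ℝ) • ![Real.cos t, Real.cos (t + 2 * Real.pi / 3),
        Real.cos (t + 4 * Real.pi / 3)]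
    (K 0 + K 1 + K 2 = 0) ∧
    (∀ q : Fin 3 → ℝ, (∀ c : ℝ, q ≠ c • ![1, 1, 1]) →
      0 < ∑ i : Fin 3, (∑ j : Fin 3, K i j * q j) * (∑ j : Fin 3, Y i j * q j)) ∧
    (∀ t : ℝ, ∑ i : Fin 3,
      (∑ j : Fin 3, K i j * Z' t j) * (∑ j : Fin 3, Y i j * Z t j) < 0) := by
  intro K Y Z Z'
  refine ⟨?_, ?_, ?_⟩
  · ext j
    fin_cases j <;> simp [K]
  · intro q hq
    have hne : q 0 ≠ q 1 ∨ q 1 ≠ q 2 := by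
      by_contra! h
      refine hq (q 0) ?_
      ext j
      fin_cases j <;> simp [h.1, h.2]
    have key : ∑ i : Fin 3, (∑ j : Fin 3, K i j * q j) * (∑ j : Fin 3, Y i j * q j)
        = ((q 0 - q 1) ^ 2 + (q 1 - q 2) ^ 2 + (q 2 - q 0) ^ 2) / 2 := by
      simp [K, Y, Fin.sum_univ_three]
      ring
    rw [key]
    rcases hne with h | h
    · have := sq_pos_of_ne_zero (sub_ne_zero.mpr h)
      positivity
    · have := sq_pos_of_ne_zero (sub_ne_zero.mpr h)
      positivity
  · intro t
    have hs : sin (2 * π / 3) = √3 / 2 := by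
      rw [show 2 * π / 3 = π - π / 3 by ring, sin_pi_sub, sin_pi_div_three]
    have hc : cos (2 * π / 3) = -(1 / 2) := by
      rw [show 2 * π / 3 = π - π / 3 by ring, cos_pi_sub, cos_pi_div_three]
    have hs' : sin (4 * π / 3) = -(√3 / 2) := by
      rw [show 4 * π / 3 = π / 3 + π by ring, sin_add_pi, sin_pi_div_three]
    have hc' : cos (4 * π / 3) = -(1 / 2) := by
      rw [show 4 * π / 3 = π / 3 + π by ring, cos_add_pi, cos_pi_div_three]
    have key : ∑ i : Fin 3, (∑ j : Fin 3, K i j * Z' t j) * (∑ j : Fin 3, Y i j * Z t j)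
        = -(√3 / 4) := by
      simp only [K, Y, Z, Z', Fin.sum_univ_three, sin_add, cos_add, hs, hc, hs', hc']
      simp
      linear_combination (-(cos t * sin t) / 12) * Real.sq_sqrt (show (0 : ℝ) ≤ 3 by norm_num)
        - √3 / 4 * sin_sq_add_cos_sq t
    rw [key]
    have : 0 < √3 := by positivity
    linarith
end
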